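/- arXiv:2204.03826 — 9 statements merged into one kernel-verified Lean document; each statement's English description precedes it below -/
import Mathlib

section
/- Let G be a finite nonabelian group and let S, T, U be subsets of G satisfying the triple product property. Then |S|·|T|·|U| ≤ |G|^{3/2} / n(G)^{1/2} + |G|. -/
/-- The quotient set `Q(X) = {x * x'⁻¹ : x, x' ∈ X}` of a subset of a group. -/
def quotientSet {G : Type*} [Group G] (X : Set G) : Set G :=
  {q | ∃ x ∈ X, ∃ x' ∈ X, q = x * x'⁻¹}

/-- Subsets `S`, `T`, `U` of a group satisfy the triple product property if
`s * t * u = 1` with `s ∈ Q(S)`, `t ∈ Q(T)`, `u ∈ Q(U)` implies `s = t = u = 1`. -/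
def TripleProductProperty {G : Type*} [Group G] (S T U : Set G) : Prop :=
  ∀ s ∈ quotientSet S, ∀ t ∈ quotientSet T, ∀ u ∈ quotientSet U,
    s * t * u = 1 → s = 1 ∧ t = 1 ∧ u = 1

/-- `n(G)`: the smallest dimension of a complex irreducible representation of `G`
of dimension greater than `1`. -/
noncomputable def minNontrivIrrepDim (G : Type) [Group G] [Fintype G] : ℕ :=
  sInf {d : ℕ | 1 < d ∧
    ∃ V : FDRep ℂ G, CategoryTheory.Simple V ∧ Module.finrank ℂ V = d}

/-- An irreducible complex representation of a finite group is a simple object of `FDRep`. -/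
lemma FDRep.simple_of_isIrreducible {G V : Type} [Group G] [Finite G] [AddCommGroup V]
    [Module ℂ V] [FiniteDimensional ℂ V] (ρ : Representation ℂ G V) [ρ.IsIrreducible] :
    CategoryTheory.Simple (FDRep.of ρ) := by
  have : NeZero (Nat.card G : ℂ) := ⟨by exact_mod_cast Nat.card_pos.ne'⟩
  rw [FDRep.simple_iff_end_is_rank_one]
  rw [← (FDRep.forget₂HomLinearEquiv (FDRep.of ρ) (FDRep.of ρ)).finrank_eq,
    (Rep.homLinearEquiv _ _).finrank_eq]
  exact Representation.IsIrreducible.finrank_intertwiningMap_self ρ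

/-- Every nonzero finite-dimensional representation contains an irreducible subrepresentation. -/
lemma Representation.exists_isIrreducible {G k V : Type*} [Monoid G] [Field k] [AddCommGroup V]
    [Module k V] [FiniteDimensional k V] [Nontrivial V] (ρ : Representation k G V) :
    ∃ W : Subrepresentation ρ, W.toRepresentation.IsIrreducible := by
  obtain ⟨W, hW, hmin⟩ := (InvImage.wf (Subrepresentation.toSubmodule (ρ := ρ))
    (wellFounded_lt (α := Submodule k V))).has_min {W | W ≠ ⊥}
    ⟨⊤, fun h => by
      have : (⊤ : Submodule k V) = ⊥ := congrArg Subrepresentation.toSubmodule h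
      exact top_ne_bot this⟩
  have hW' : W.toSubmodule ≠ ⊥ := fun h => hW (Subrepresentation.toSubmodule_injective h)
  refine ⟨W, @IsSimpleOrder.mk _ _ _ ?_ fun σ => ?_⟩
  · refine ⟨⊥, ⊤, fun h => ?_⟩
    have h1 : (⊥ : Submodule k W.toSubmodule) = ⊤ := congrArg Subrepresentation.toSubmodule h
    have := Submodule.nontrivial_iff_ne_bot.mpr hW'
    exact bot_ne_top h1
  · by_contra! hσ
    let τ : Subrepresentation ρ := ⟨σ.toSubmodule.map W.toSubmodule.subtype, by
      rintro g _ ⟨v, hv, rfl⟩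
      exact ⟨_, σ.apply_mem_toSubmodule g hv, rfl⟩⟩
    refine hmin τ (fun h => hσ.1 ?_) ?_
    · have h1 : σ.toSubmodule.map W.toSubmodule.subtype = ⊥ :=
        congrArg Subrepresentation.toSubmodule h
      rw [← Submodule.map_bot W.toSubmodule.subtype] at h1
      exact Subrepresentation.toSubmodule_injective
        (Submodule.map_injective_of_injective W.toSubmodule.injective_subtype h1)
    · refine lt_of_le_of_ne (Submodule.map_subtype_le _ _) fun h => hσ.2 ?_
      apply Subrepresentation.toSubmodule_injective
      refine eq_top_iff.mpr fun x _ => ?_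
      have : (x : V) ∈ τ.toSubmodule := by rw [h]; exact x.2
      obtain ⟨y, hy, hyx⟩ := this
      rwa [← Subtype.ext hyx]

/-- The commutator subgroup acts trivially in a one-dimensional representation. -/
lemma Representation.apply_of_mem_commutator {G k V : Type*} [Group G] [Field k] [AddCommGroup V]
    [Module k V] (ρ : Representation k G V) (h : Module.finrank k V = 1) {x : G}
    (hx : x ∈ commutator G) : ρ x = 1 := by
  suffices commutator G ≤ MonoidHom.ker ρ from MonoidHom.mem_ker.mp (this hx)
  refine Subgroup.commutator_le.mpr fun a _ b _ => MonoidHom.mem_ker.mpr ?_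
  obtain ⟨v, hv, hspan⟩ := finrank_eq_one_iff'.mp h
  have hcomm : ρ a * ρ b = ρ b * ρ a := by
    ext w
    obtain ⟨c, rfl⟩ := hspan w
    obtain ⟨α, hα⟩ := hspan (ρ a v)
    obtain ⟨β, hβ⟩ := hspan (ρ b v)
    simp [← hα, ← hβ, smul_smul, mul_comm]
  rw [commutatorElement_def, map_mul, map_mul, map_mul, hcomm, mul_assoc (ρ b), ← map_mul ρ a]
  simp [← map_mul]

/-- A nonzero representation with no nonzero vector fixed by the commutator subgroup has dimension
at least `minNontrivIrrepDim G`. -/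
lemma minNontrivIrrepDim_le_finrank {G V : Type} [Group G] [Fintype G] [AddCommGroup V]
    [Module ℂ V] [FiniteDimensional ℂ V] [Nontrivial V] (ρ : Representation ℂ G V)
    (h : ∀ v, (∀ k ∈ commutator G, ρ k v = v) → v = 0) :
    0 < minNontrivIrrepDim G ∧ minNontrivIrrepDim G ≤ Module.finrank ℂ V := by
  obtain ⟨W, hW⟩ := ρ.exists_isIrreducible
  have hnt : Nontrivial W.toSubmodule := by
    rw [Submodule.nontrivial_iff_ne_bot]
    intro h0
    apply bot_ne_top (α := Subrepresentation W.toRepresentation)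
    apply Subrepresentation.toSubmodule_injective
    have : Subsingleton W.toSubmodule := by rw [h0]; infer_instance
    exact Subsingleton.elim _ _
  have hmem : Module.finrank ℂ W.toSubmodule ∈ {d : ℕ | 1 < d ∧
      ∃ V : FDRep ℂ G, CategoryTheory.Simple V ∧ Module.finrank ℂ V = d} := by
    refine ⟨?_, FDRep.of W.toRepresentation, FDRep.simple_of_isIrreducible _, rfl⟩
    have hpos : 0 < Module.finrank ℂ W.toSubmodule := Module.finrank_pos
    refine lt_of_le_of_ne hpos fun h1 => ?_
    obtain ⟨v, hv⟩ := exists_ne (0 : W.toSubmodule)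
    refine hv (Subtype.ext (h v fun k hk => ?_))
    have := LinearMap.congr_fun (W.toRepresentation.apply_of_mem_commutator h1.symm hk) v
    exact congrArg Subtype.val this
  exact ⟨zero_lt_one.trans (Nat.sInf_mem ⟨_, hmem⟩).1,
    (Nat.sInf_le hmem).trans (Submodule.finrank_le _)⟩

/-- The largest eigenvalue of `T† T` for a nonzero linear map `T` is positive and bounds the
squared operator norm of `T`. -/
lemma LinearMap.exists_eigenspace_adjoint_comp_self {E F : Type*} [NormedAddCommGroup E]
    [InnerProductSpace ℂ E] [FiniteDimensional ℂ E] [NormedAddCommGroup F]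
    [InnerProductSpace ℂ F] [FiniteDimensional ℂ F] (T : E →ₗ[ℂ] F) (hT : T ≠ 0) :
    ∃ μ : ℝ, 0 < μ ∧ Module.End.eigenspace (T.adjoint ∘ₗ T) (μ : ℂ) ≠ ⊥ ∧
      ∀ f, ‖T f‖ ^ 2 ≤ μ * ‖f‖ ^ 2 := by
  obtain ⟨f₀, hf₀⟩ : ∃ f, T f ≠ 0 := by
    by_contra! h
    exact hT (LinearMap.ext h)
  have hf₀' : f₀ ≠ 0 := fun h => hf₀ (by simp [h])
  have : Nontrivial E := ⟨f₀, 0, hf₀'⟩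
  have hsymm : (T.adjoint ∘ₗ T).IsSymmetric := fun x y => by
    simp [LinearMap.adjoint_inner_left, LinearMap.adjoint_inner_right]
  have hre (x : E) : RCLike.re (inner ℂ ((T.adjoint ∘ₗ T) x) x) = ‖T x‖ ^ 2 := by
    rw [LinearMap.comp_apply, LinearMap.adjoint_inner_left]
    exact inner_self_eq_norm_sq _
  have heig := hsymm.hasEigenvalue_iSup_of_finiteDimensional
  set μ : ℝ := ⨆ x : { x : E // x ≠ 0 },
    RCLike.re (inner ℂ ((T.adjoint ∘ₗ T) x) (x : E)) / ‖(x : E)‖ ^ 2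
  have hbdd : BddAbove (Set.range fun x : { x : E // x ≠ 0 } =>
      RCLike.re (inner ℂ ((T.adjoint ∘ₗ T) x) (x : E)) / ‖(x : E)‖ ^ 2) := by
    refine ⟨‖T.toContinuousLinearMap‖ ^ 2, ?_⟩
    rintro _ ⟨⟨x, hx⟩, rfl⟩
    have hx' : 0 < ‖x‖ := norm_pos_iff.mpr hx
    simp only [hre]
    rw [div_le_iff₀ (by positivity), ← mul_pow]
    gcongr
    exact T.toContinuousLinearMap.le_opNorm x
  have hle (f : E) : ‖T f‖ ^ 2 ≤ μ * ‖f‖ ^ 2 := by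
    by_cases hf : f = 0
    · simp [hf]
    have hf' : 0 < ‖f‖ := norm_pos_iff.mpr hf
    rw [← div_le_iff₀ (by positivity), ← hre]
    exact le_ciSup hbdd ⟨f, hf⟩
  refine ⟨μ, ?_, heig, hle⟩
  have h1 : 0 < ‖T f₀‖ ^ 2 := by positivity
  exact pos_of_mul_pos_left (h1.trans_le (hle f₀)) (by positivity)

/-- An eigenvalue of `Mᴴ M` times its multiplicity is at most the squared Frobenius norm of `M`. -/
lemma Matrix.finrank_eigenspace_mul_le {ι : Type*} [Fintype ι] [DecidableEq ι] (M : Matrix ι ι ℂ)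
    (μ : ℝ) :
    Module.finrank ℂ (Module.End.eigenspace
      (M.toEuclideanLin.adjoint ∘ₗ M.toEuclideanLin) (μ : ℂ)) * μ ≤ ∑ x, ∑ y, ‖M x y‖ ^ 2 := by
  set T := M.toEuclideanLin with hT
  set W := Module.End.eigenspace (T.adjoint ∘ₗ T) (μ : ℂ)
  let e := stdOrthonormalBasis ℂ W
  have he : Orthonormal ℂ fun i => (e i : EuclideanSpace ℂ ι) :=
    e.orthonormal.comp_linearIsometry W.subtypeₗᵢ
  have hnorm (i) : ‖T (e i)‖ ^ 2 = μ := by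
    have h1 : (T.adjoint ∘ₗ T) (e i : EuclideanSpace ℂ ι) = (μ : ℂ) • (e i : EuclideanSpace ℂ ι) :=
      Module.End.mem_eigenspace_iff.mp (e i).2
    have h2 : (inner ℂ (T (e i)) (T (e i)) : ℂ) = μ := by
      rw [← LinearMap.adjoint_inner_right, ← LinearMap.comp_apply, h1, inner_smul_right,
        inner_self_eq_norm_sq_to_K, he.1 i]
      simp
    rw [inner_self_eq_norm_sq_to_K] at h2
    exact Complex.ofReal_injective (by simpa using h2)
  let r (x : ι) : EuclideanSpace ℂ ι := WithLp.toLp 2 fun y => star (M x y)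
  have hr (x : ι) (v : EuclideanSpace ℂ ι) : ‖T v x‖ = ‖(inner ℂ v (r x) : ℂ)‖ := by
    rw [← norm_inner_symm]
    simp [r, hT, Matrix.toLpLin_apply, Matrix.mulVec, dotProduct, PiLp.inner_apply, mul_comm]
  calc _ = ∑ i, ‖T (e i)‖ ^ 2 := by simp [hnorm]
    _ = ∑ x, ∑ i, ‖(inner ℂ (e i : EuclideanSpace ℂ ι) (r x) : ℂ)‖ ^ 2 := by
      simp_rw [EuclideanSpace.norm_sq_eq, hr]
      exact Finset.sum_comm
    _ ≤ ∑ x, ‖r x‖ ^ 2 := Finset.sum_le_sum fun x _ => he.sum_inner_products_le _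
    _ = _ := by simp [EuclideanSpace.norm_sq_eq, r]

/-- The right regular representation on `EuclideanSpace ℂ G`. -/
def rightTranslation (G : Type*) [Group G] : Representation ℂ G (EuclideanSpace ℂ G) where
  toFun g :=
    { toFun := fun f => WithLp.toLp 2 fun x => f (x * g)
      map_add' := fun _ _ => rfl
      map_smul' := fun _ _ => rfl }
  map_one' := by ext; simp
  map_mul' a b := by
    refine LinearMap.ext fun f => ?_
    ext x
    exact congrArg f.ofLp (mul_assoc x a b).symm

@[simp]
lemma rightTranslation_apply {G : Type*} [Group G] (g : G) (f : EuclideanSpace ℂ G) (x : G) :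
    rightTranslation G g f x = f (x * g) := rfl

/-- The matrix of left convolution by `b`. -/
def convMatrix {G : Type*} [Group G] (b : G → ℂ) : Matrix G G ℂ := Matrix.of fun x y => b (x * y⁻¹)

open scoped Classical in
lemma convMatrix_toEuclideanLin_apply {G : Type*} [Group G] [Fintype G] (b : G → ℂ)
    (f : EuclideanSpace ℂ G) (x : G) :
    (convMatrix b).toEuclideanLin f x = ∑ y, b (x * y⁻¹) * f y := by
  simp [Matrix.toLpLin_apply, Matrix.mulVec, dotProduct, convMatrix]

open scoped Classical in
lemma convMatrix_rightTranslation {G : Type*} [Group G] [Fintype G] (b : G → ℂ) (g : G)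
    (f : EuclideanSpace ℂ G) :
    (convMatrix b).toEuclideanLin (rightTranslation G g f) =
      rightTranslation G g ((convMatrix b).toEuclideanLin f) := by
  ext x
  simp only [convMatrix_toEuclideanLin_apply, rightTranslation_apply]
  exact Fintype.sum_equiv (Equiv.mulRight g) _ _ fun y => by simp [mul_assoc]

lemma convMatrix_conjTranspose {G : Type*} [Group G] (b : G → ℂ) :
    (convMatrix b).conjTranspose = convMatrix fun x => star (b x⁻¹) := by
  ext x y
  simp [convMatrix]

open scoped Classical in
/-- **Babai–Nikolov–Pyber inequality**: convolution by a function with vanishing sums over the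
cosets of the commutator subgroup has small operator norm. -/
lemma norm_sq_convMatrix_le {G : Type} [Group G] [Fintype G] (b : G → ℂ)
    (hb : ∀ x y, ∑ k : commutator G, b (x * k * y) = 0) :
    (convMatrix b).toEuclideanLin = 0 ∨ 0 < minNontrivIrrepDim G ∧ ∀ f : EuclideanSpace ℂ G,
      minNontrivIrrepDim G * ‖(convMatrix b).toEuclideanLin f‖ ^ 2 ≤
        Fintype.card G * (∑ x, ‖b x‖ ^ 2) * ‖f‖ ^ 2 := by
  refine or_iff_not_imp_left.mpr fun hT => ?_
  obtain ⟨μ, hμ, hW, hle⟩ := LinearMap.exists_eigenspace_adjoint_comp_self _ hT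
  have hfro := (convMatrix b).finrank_eigenspace_mul_le μ
  set T := (convMatrix b).toEuclideanLin with hTdef
  have hadj (g : G) (v : EuclideanSpace ℂ G) :
      T.adjoint (rightTranslation G g v) = rightTranslation G g (T.adjoint v) := by
    rw [hTdef, ← Matrix.toEuclideanLin_conjTranspose_eq_adjoint, convMatrix_conjTranspose,
      convMatrix_rightTranslation]
  let W : Subrepresentation (rightTranslation G) :=
    ⟨Module.End.eigenspace (T.adjoint ∘ₗ T) (μ : ℂ), fun g v hv => by
      rw [Module.End.mem_eigenspace_iff] at hv ⊢
      rw [← map_smul, ← hv, LinearMap.comp_apply, convMatrix_rightTranslation, hadj]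
      rfl⟩
  have : Nontrivial W.toSubmodule := Submodule.nontrivial_iff_ne_bot.mpr hW
  obtain ⟨hpos, hdim⟩ := minNontrivIrrepDim_le_finrank W.toRepresentation (by
    rintro ⟨v, hv⟩ hfix
    have hfix' (k : commutator G) (x : G) : v (x * k) = v x :=
      congrArg (fun f : EuclideanSpace ℂ G => f x) (congrArg Subtype.val (hfix k k.2))
    have hTv : T v = 0 := by
      ext x
      have h1 (k : commutator G) : T v x = ∑ y, b (x * k * y⁻¹) * v y := by
        rw [convMatrix_toEuclideanLin_apply]
        refine Fintype.sum_equiv (Equiv.mulRight (k : G)) _ _ fun y => ?_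
        simp [hfix', mul_assoc]
      have h2 : ∑ k : commutator G, T v x = 0 := by
        rw [Finset.sum_congr rfl fun k _ => h1 k, Finset.sum_comm]
        simp [← Finset.sum_mul, hb]
      simpa using h2
    have h3 : (T.adjoint ∘ₗ T) v = (μ : ℂ) • v := Module.End.mem_eigenspace_iff.mp hv
    rw [LinearMap.comp_apply, hTv, map_zero, eq_comm, smul_eq_zero] at h3
    exact Subtype.ext (h3.resolve_left (by exact_mod_cast hμ.ne')))
  refine ⟨hpos, fun f => ?_⟩
  have hsum : ∑ x, ∑ y, ‖convMatrix b x y‖ ^ 2 = Fintype.card G * ∑ x, ‖b x‖ ^ 2 := by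
    have (x : G) : ∑ y, ‖convMatrix b x y‖ ^ 2 = ∑ y, ‖b y‖ ^ 2 :=
      Fintype.sum_equiv ((Equiv.inv G).trans (Equiv.mulLeft x)) _ _ fun y => rfl
    simp [this]
  have hdim' : (minNontrivIrrepDim G : ℝ) ≤ Module.finrank ℂ W.toSubmodule := by
    exact_mod_cast hdim
  calc (minNontrivIrrepDim G : ℝ) * ‖T f‖ ^ 2
      ≤ Module.finrank ℂ W.toSubmodule * (μ * ‖f‖ ^ 2) := by
        gcongr
        exact hle f
    _ = Module.finrank ℂ W.toSubmodule * μ * ‖f‖ ^ 2 := by ring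
    _ ≤ _ := mul_le_mul_of_nonneg_right (hfro.trans hsum.le) (sq_nonneg _)

open scoped Classical in
/-- The class function `[g = 1] - [g ∈ N] / |N|` for `N` the commutator subgroup, the convolution
idempotent projecting onto the functions with vanishing sums over the cosets of `N`. -/
noncomputable def commutatorComplement {G : Type*} [Group G] [Fintype G] (g : G) : ℝ :=
  (if g = 1 then 1 else 0) - (if g ∈ commutator G then 1 else 0) / Fintype.card (commutator G)

open scoped Classical in
lemma commutatorComplement_mul_comm {G : Type*} [Group G] [Fintype G] (x y : G) :
    commutatorComplement (x * y) = commutatorComplement (y * x) := by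
  have h1 : x * y = 1 ↔ y * x = 1 := mul_eq_one_comm
  have h2 : x * y ∈ commutator G ↔ y * x ∈ commutator G :=
    (inferInstance : (commutator G).Normal).mem_comm_iff
  simp only [commutatorComplement]
  congr 1
  · exact if_congr h1 rfl rfl
  · congr 1
    exact if_congr h2 rfl rfl

open scoped Classical in
lemma sum_commutatorComplement {G : Type*} [Group G] [Fintype G] (x y : G) :
    ∑ k : commutator G, commutatorComplement (x * k * y) = 0 := by
  have hcard : (Fintype.card (commutator G) : ℝ) ≠ 0 := by exact_mod_cast Fintype.card_ne_zero
  have h1 (k : commutator G) : commutatorComplement (x * k * y) =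
      (if y * x * k = 1 then (1 : ℝ) else 0) -
        (if y * x ∈ commutator G then 1 else 0) / Fintype.card (commutator G) := by
    rw [commutatorComplement_mul_comm, ← mul_assoc, commutatorComplement]
    simp only [Subgroup.mul_mem_cancel_right _ k.2]
  have h2 : ∑ k : commutator G, (if y * x * k = 1 then (1 : ℝ) else 0) =
      if y * x ∈ commutator G then 1 else 0 := by
    split_ifs with h
    · rw [Finset.sum_eq_single_of_mem (⟨y * x, h⟩⁻¹ : commutator G) (Finset.mem_univ _)]
      · simp
      · intro k _ hk
        refine if_neg fun h' => hk (Subtype.ext ?_)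
        exact eq_inv_of_mul_eq_one_right h'
    · refine Finset.sum_eq_zero fun k _ => if_neg fun h' => h ?_
      rw [eq_inv_of_mul_eq_one_left h']
      exact inv_mem k.2
  simp only [h1, Finset.sum_sub_distrib, h2, Finset.sum_const, Finset.card_univ, nsmul_eq_mul]
  field_simp
  simp

open scoped Classical in
lemma sum_commutatorComplement_mul {G : Type*} [Group G] [Fintype G] (x y : G) :
    ∑ g, commutatorComplement (x * g) * commutatorComplement (y * g) =
      commutatorComplement (x * y⁻¹) := by
  have h1 : ∑ g, commutatorComplement (x * g) * (if y * g ∈ commutator G then 1 else 0) = 0 := by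
    calc _ = ∑ g, commutatorComplement (x * (y⁻¹ * g)) * (if g ∈ commutator G then 1 else 0) :=
          (Fintype.sum_equiv (Equiv.mulLeft y⁻¹) _ _ fun g => by simp).symm
      _ = ∑ k : commutator G, commutatorComplement (x * y⁻¹ * k * 1) := by
          simp only [mul_ite, mul_one, mul_zero, ← mul_assoc]
          rw [← Finset.sum_filter]
          exact Finset.sum_subtype _ (by simp) _
      _ = 0 := sum_commutatorComplement _ _
  have h2 : ∑ g, commutatorComplement (x * g) * (if y * g = 1 then 1 else 0) =
      commutatorComplement (x * y⁻¹) := by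
    rw [Finset.sum_eq_single_of_mem y⁻¹ (Finset.mem_univ _)]
    · simp
    · intro g _ hg
      rw [if_neg fun h => hg (eq_inv_of_mul_eq_one_right h), mul_zero]
  rw [← h2]
  conv_lhs => enter [2, g]; rw [commutatorComplement.eq_def (y * g)]
  simp only [mul_sub, Finset.sum_sub_distrib, ← mul_div_assoc]
  rw [← Finset.sum_div, h1, zero_div, sub_zero]

open scoped Classical in
lemma sum_sq_sum_commutatorComplement_le {G : Type*} [Group G] [Fintype G] (A : Finset G) :
    ∑ g, (∑ x ∈ A, commutatorComplement (x * g)) ^ 2 ≤ A.card := by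
  calc _ = ∑ x ∈ A, ∑ y ∈ A, commutatorComplement (x * y⁻¹) := by
        simp_rw [sq, Finset.sum_mul_sum]
        rw [Finset.sum_comm]
        refine Finset.sum_congr rfl fun x _ => ?_
        rw [Finset.sum_comm]
        exact Finset.sum_congr rfl fun y _ => sum_commutatorComplement_mul x y
    _ ≤ ∑ x ∈ A, ∑ y ∈ A, if x = y then (1 : ℝ) else 0 := by
        refine Finset.sum_le_sum fun x _ => Finset.sum_le_sum fun y _ => ?_
        simp only [commutatorComplement, mul_inv_eq_one]
        exact sub_le_self _ (by positivity)
    _ = _ := by simp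

open scoped Classical in
/-- The mixing estimate for three subsets of a group. -/
lemma sq_sum_commutatorComplement_le {G : Type} [Group G] [Fintype G] (A B C : Finset G) :
    (∑ w ∈ A ×ˢ B ×ˢ C, commutatorComplement (w.1 * w.2.1 * w.2.2)) ^ 2 ≤
      Fintype.card G / minNontrivIrrepDim G * (A.card * B.card * C.card) := by
  let b (g : G) : ℂ := ((∑ x ∈ A, commutatorComplement (x * g) : ℝ) : ℂ)
  have hb (x y : G) : ∑ k : commutator G, b (x * k * y) = 0 := by
    simp only [b]
    rw [← Complex.ofReal_sum, Finset.sum_comm]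
    simp_rw [← mul_assoc, sum_commutatorComplement]
    simp
  let f : EuclideanSpace ℂ G := WithLp.toLp 2 fun w => if w⁻¹ ∈ C then 1 else 0
  have hf : ‖f‖ ^ 2 = C.card := by
    rw [EuclideanSpace.norm_sq_eq, ← Fintype.sum_equiv (Equiv.inv G)
      (fun w => if w ∈ C then (1 : ℝ) else 0)]
    · simp
    · intro w
      by_cases hw : w ∈ C <;> simp [f, hw]
  have hbsum : ∑ x, ‖b x‖ ^ 2 ≤ A.card := by
    simpa [b, -Complex.ofReal_sum] using sum_sq_sum_commutatorComplement_le A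
  have herr : ((∑ w ∈ A ×ˢ B ×ˢ C, commutatorComplement (w.1 * w.2.1 * w.2.2) : ℝ) : ℂ) =
      ∑ y ∈ B, (convMatrix b).toEuclideanLin f y := by
    have (y : G) : (convMatrix b).toEuclideanLin f y = ∑ z ∈ C, b (y * z) := by
      rw [convMatrix_toEuclideanLin_apply, ← Fintype.sum_equiv (Equiv.inv G)
        (fun w => if w ∈ C then b (y * w) else 0)]
      · simp
      · intro w
        by_cases hw : w ∈ C <;> simp [f, hw]
    simp only [this, b, ← Complex.ofReal_sum]
    rw [Finset.sum_product, Finset.sum_comm' (t' := B ×ˢ C) (s' := fun _ => A) (by tauto)]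
    rw [Finset.sum_product]
    simp only [mul_assoc]
  rcases norm_sq_convMatrix_le b hb with h0 | ⟨hpos, hle⟩
  · rw [h0] at herr
    have : ∑ w ∈ A ×ˢ B ×ˢ C, commutatorComplement (w.1 * w.2.1 * w.2.2) = 0 :=
      Complex.ofReal_injective (by rw [herr]; simp)
    rw [this, zero_pow two_ne_zero]
    positivity
  · have hpos' : (0 : ℝ) < minNontrivIrrepDim G := by exact_mod_cast hpos
    rw [div_mul_eq_mul_div, le_div_iff₀ hpos']
    calc _ = ‖∑ y ∈ B, (convMatrix b).toEuclideanLin f y‖ ^ 2 * minNontrivIrrepDim G := by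
          rw [← herr, Complex.norm_real, Real.norm_eq_abs, sq_abs]
      _ ≤ (B.card * ‖(convMatrix b).toEuclideanLin f‖ ^ 2) * minNontrivIrrepDim G := by
          gcongr
          calc _ ≤ (∑ y ∈ B, ‖(convMatrix b).toEuclideanLin f y‖) ^ 2 := by
                gcongr
                exact norm_sum_le _ _
            _ ≤ B.card * ∑ y ∈ B, ‖(convMatrix b).toEuclideanLin f y‖ ^ 2 :=
                sq_sum_le_card_mul_sum_sq
            _ ≤ _ := by
                rw [EuclideanSpace.norm_sq_eq]
                gcongr
                exact Finset.subset_univ _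
      _ = B.card * (minNontrivIrrepDim G * ‖(convMatrix b).toEuclideanLin f‖ ^ 2) := by ring
      _ ≤ B.card * (Fintype.card G * A.card * C.card) := by
          refine mul_le_mul_of_nonneg_left ((hle f).trans ?_) (by positivity)
          rw [hf]
          gcongr
      _ = _ := by ring

open scoped Classical in
/-- A map from a finite set to a finite type has many collisions. -/
lemma sq_card_le_card_mul_sum_ite {α β : Type*} [Fintype β] (X : Finset α) (ψ : α → β) :
    (X.card : ℝ) ^ 2 ≤ Fintype.card β * ∑ w ∈ X ×ˢ X, if ψ w.1 = ψ w.2 then 1 else 0 := by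
  have h1 : ∑ r : β, ∑ p ∈ X, (if ψ p = r then (1 : ℝ) else 0) = X.card := by
    rw [Finset.sum_comm]
    simp
  rw [← h1]
  refine sq_sum_le_card_mul_sum_sq.trans_eq ?_
  rw [Finset.card_univ]
  congr 1
  simp_rw [sq, Finset.sum_mul_sum]
  rw [Finset.sum_product, Finset.sum_comm]
  refine Finset.sum_congr rfl fun p _ => ?_
  rw [Finset.sum_comm]
  refine Finset.sum_congr rfl fun q _ => ?_
  simp [eq_comm]

namespace TripleProductProperty

variable {G : Type*} [Group G] {S T U : Set G}

lemma eq_of_mul_eq_one (h : TripleProductProperty S T U) {s s' t t' u u' : G} (hs : s ∈ S)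
    (hs' : s' ∈ S) (ht : t ∈ T) (ht' : t' ∈ T) (hu : u ∈ U) (hu' : u' ∈ U)
    (heq : s⁻¹ * t * (t'⁻¹ * u) * (u'⁻¹ * s') = 1) : s' = s ∧ t = t' ∧ u = u' := by
  have := h _ ⟨s', hs', s, hs, rfl⟩ _ ⟨t, ht, t', ht', rfl⟩ _ ⟨u, hu, u', hu', rfl⟩ (by
    have h1 := congrArg (fun g => s' * g * s'⁻¹) heq
    simpa [mul_assoc] using h1)
  simpa only [mul_inv_eq_one] using this

lemma rotate (h : TripleProductProperty S T U) : TripleProductProperty T U S := by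
  intro t ht u hu s hs heq
  have := h s hs t ht u hu (by rw [mul_assoc, ← mul_eq_one_comm.mp heq])
  tauto

lemma injOn (h : TripleProductProperty S T U) (hU : U.Nonempty) :
    Set.InjOn (fun p : G × G => p.1⁻¹ * p.2) (S ×ˢ T) := by
  rintro ⟨s, t⟩ ⟨hs, ht⟩ ⟨s', t'⟩ ⟨hs', ht'⟩ heq
  obtain ⟨u, hu⟩ := hU
  have heq' : s⁻¹ * t = s'⁻¹ * t' := heq
  obtain ⟨h1, h2, -⟩ := h.eq_of_mul_eq_one hs hs' ht ht' hu hu (by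
    rw [heq']; group)
  exact Prod.ext h1.symm h2

open scoped Classical in
lemma sum_ite_le (S T U : Finset G) (h : TripleProductProperty (S : Set G) T U) :
    ∑ w ∈ (S ×ˢ T).image (fun p => p.1⁻¹ * p.2) ×ˢ (T ×ˢ U).image (fun p => p.1⁻¹ * p.2) ×ˢ
      (U ×ˢ S).image (fun p => p.1⁻¹ * p.2), (if w.1 * w.2.1 * w.2.2 = 1 then (1 : ℝ) else 0) ≤
      S.card * T.card * U.card := by
  rw [Finset.sum_boole]
  have : (S.card * T.card * U.card : ℝ) = ((S ×ˢ T ×ˢ U).card : ℝ) := by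
    simp [mul_assoc]
  rw [this, Nat.cast_le]
  refine (Finset.card_le_card ?_).trans (Finset.card_image_le
    (f := fun p : G × G × G => (p.1⁻¹ * p.2.1, p.2.1⁻¹ * p.2.2, p.2.2⁻¹ * p.1)))
  rintro ⟨x, y, z⟩ hw
  simp only [Finset.mem_filter, Finset.mem_product, Finset.mem_image, Prod.exists] at hw ⊢
  obtain ⟨⟨⟨s, t, ⟨hs, ht⟩, rfl⟩, ⟨t', u, ⟨ht', hu⟩, rfl⟩, ⟨u', s', ⟨hu', hs'⟩, rfl⟩⟩, heq⟩ := hw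
  obtain ⟨rfl, rfl, rfl⟩ := h.eq_of_mul_eq_one hs hs' ht ht' hu hu' heq
  exact ⟨_, _, _, ⟨hs, ht, hu⟩, rfl⟩

open scoped Classical in
lemma sq_le_sum_ite_mem [Fintype G] (S T U : Finset G) (h : TripleProductProperty (S : Set G) T U)
    (hS : S.Nonempty) (hT : T.Nonempty) (hU : U.Nonempty) :
    (S.card * T.card * U.card : ℝ) ^ 2 ≤ Fintype.card G *
      ∑ w ∈ (S ×ˢ T).image (fun p => p.1⁻¹ * p.2) ×ˢ (T ×ˢ U).image (fun p => p.1⁻¹ * p.2) ×ˢ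
        (U ×ˢ S).image (fun p => p.1⁻¹ * p.2),
        (if w.1 * w.2.1 * w.2.2 ∈ commutator G then (1 : ℝ) else 0) /
          Fintype.card (commutator G) := by
  have hcard : (Fintype.card G : ℝ) =
      Fintype.card (Abelianization G) * Fintype.card (commutator G) := by
    have := Subgroup.card_eq_card_quotient_mul_card_subgroup (commutator G)
    simp only [Nat.card_eq_fintype_card] at this
    exact_mod_cast this
  have hpos : (0 : ℝ) < Fintype.card (commutator G) := by exact_mod_cast Fintype.card_pos
  have hinjTU : Set.InjOn (fun p : G × G => p.1⁻¹ * p.2) (T ×ˢ U : Finset (G × G)) := by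
    simpa using h.rotate.injOn hS
  have hinjUS : Set.InjOn (fun p : G × G => p.1⁻¹ * p.2) (U ×ˢ S : Finset (G × G)) := by
    simpa using h.rotate.rotate.injOn hT
  have hcoll := sq_card_le_card_mul_sum_ite (S ×ˢ T ×ˢ U)
    fun p => Abelianization.of (p.1 * p.2.1 * p.2.2)
  rw [← Finset.sum_div, hcard, mul_assoc (Fintype.card (Abelianization G) : ℝ), mul_div_cancel₀ _ hpos.ne']
  convert hcoll using 2
  · simp [mul_assoc]
  · rw [Finset.sum_product, Finset.sum_image (by simpa using h.injOn hU)]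
    simp_rw [Finset.sum_product (s := Finset.image _ _)]
    simp_rw [Finset.sum_image hinjTU, Finset.sum_image hinjUS]
    simp_rw [← Finset.sum_product']
    refine Finset.sum_nbij' (fun w => ((w.2.2.2, w.1.2, w.2.1.2), (w.1.1, w.2.1.1, w.2.2.1)))
      (fun w => ((w.2.1, w.1.2.1), (w.2.2.1, w.1.2.2), (w.2.2.2, w.1.1))) ?_ ?_ ?_ ?_ ?_
    · simp +contextual
    · simp +contextual
    · simp
    · simp
    · rintro ⟨⟨s, t⟩, ⟨t', u⟩, ⟨u', s'⟩⟩ -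
      have : s⁻¹ * t * (t'⁻¹ * u) * (u'⁻¹ * s') ∈ commutator G ↔
          Abelianization.of (s' * t * u) = Abelianization.of (s * t' * u') := by
        rw [← Abelianization.ker_of, MonoidHom.mem_ker]
        simp only [map_mul, map_inv]
        rw [← mul_inv_eq_one (b := Abelianization.of s * _ * _)]
        refine Eq.congr_left ?_
        simp only [mul_inv]
        ac_rfl
      simp only [this]

end TripleProductProperty

theorem stmt_0 {G : Type} [Group G] [Fintype G]
    (hnonab : ∃ a b : G, a * b ≠ b * a)
    (S T U : Set G) (h : TripleProductProperty S T U) :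
    (S.ncard : ℝ) * T.ncard * U.ncard ≤
      (Fintype.card G : ℝ) ^ ((3 : ℝ) / 2) / (minNontrivIrrepDim G : ℝ) ^ ((1 : ℝ) / 2)
        + Fintype.card G := by
  classical
  lift S to Finset G using S.toFinite
  lift T to Finset G using T.toFinite
  lift U to Finset G using U.toFinite
  simp only [Set.ncard_coe_finset]
  rcases S.eq_empty_or_nonempty with rfl | hS
  · simp only [Finset.card_empty, Nat.cast_zero, zero_mul]; positivity
  rcases T.eq_empty_or_nonempty with rfl | hT
  · simp only [Finset.card_empty, Nat.cast_zero, zero_mul, mul_zero]; positivity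
  rcases U.eq_empty_or_nonempty with rfl | hU
  · simp only [Finset.card_empty, Nat.cast_zero, mul_zero]; positivity
  have hle := h.sum_ite_le S T U
  have hmain := h.sq_le_sum_ite_mem S T U hS hT hU
  have herr := sq_sum_commutatorComplement_le ((S ×ˢ T).image fun p => p.1⁻¹ * p.2)
    ((T ×ˢ U).image fun p => p.1⁻¹ * p.2) ((U ×ˢ S).image fun p => p.1⁻¹ * p.2)
  have hA : ((((S ×ˢ T).image fun p => p.1⁻¹ * p.2).card : ℕ) : ℝ) ≤ S.card * T.card := by
    exact_mod_cast Finset.card_image_le.trans_eq (Finset.card_product _ _)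
  have hB : ((((T ×ˢ U).image fun p => p.1⁻¹ * p.2).card : ℕ) : ℝ) ≤ T.card * U.card := by
    exact_mod_cast Finset.card_image_le.trans_eq (Finset.card_product _ _)
  have hC : ((((U ×ˢ S).image fun p => p.1⁻¹ * p.2).card : ℕ) : ℝ) ≤ U.card * S.card := by
    exact_mod_cast Finset.card_image_le.trans_eq (Finset.card_product _ _)
  set A := (S ×ˢ T).image fun p => p.1⁻¹ * p.2
  set B := (T ×ˢ U).image fun p => p.1⁻¹ * p.2
  set C := (U ×ˢ S).image fun p => p.1⁻¹ * p.2
  have hP : (0 : ℝ) < S.card * T.card * U.card := by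
    have := hS.card_pos
    have := hT.card_pos
    have := hU.card_pos
    positivity
  simp only [commutatorComplement, Finset.sum_sub_distrib] at herr
  set P : ℝ := S.card * T.card * U.card
  have hG : (0 : ℝ) < Fintype.card G := by exact_mod_cast Fintype.card_pos
  set r : ℝ := √(Fintype.card G / minNontrivIrrepDim G) with hr
  have hABC : (Fintype.card G / minNontrivIrrepDim G : ℝ) * (A.card * B.card * C.card) ≤
      (r * P) ^ 2 := by
    rw [mul_pow, hr, Real.sq_sqrt (by positivity)]
    gcongr
    calc (A.card * B.card * C.card : ℝ)
        ≤ S.card * T.card * (T.card * U.card) * (U.card * S.card) := by gcongr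
      _ = P ^ 2 := by ring
  have habs := (abs_le_of_sq_le_sq' (herr.trans hABC) (by positivity)).1
  have hPle : P ≤ Fintype.card G * (1 + r) := by
    have h1 : P * P ≤ Fintype.card G * (1 + r) * P :=
      calc P * P = P ^ 2 := (sq P).symm
        _ ≤ _ := hmain
        _ ≤ Fintype.card G * (P + r * P) := by gcongr; linarith
        _ = _ := by ring
    exact le_of_mul_le_mul_right h1 hP
  refine hPle.trans_eq ?_
  have h32 : (Fintype.card G : ℝ) ^ ((3 : ℝ) / 2) = Fintype.card G * √(Fintype.card G) := by
    rw [show (3 : ℝ) / 2 = 1 + 1 / 2 by norm_num, Real.rpow_add hG, Real.rpow_one,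
      Real.sqrt_eq_rpow]
  rw [h32, ← Real.sqrt_eq_rpow, hr, Real.sqrt_div hG.le]
  ring
end

section
/- Let G be a finite group and let S, T, U be subsets of G satisfying the triple product property. Then |S|·|T|·|U| ≤ |G|^{3/2}/√2 + |G|. -/
theorem TripleProductProperty.rotate_s1 {G : Type*} [Group G] {S T U : Set G}
    (h : TripleProductProperty S T U) : TripleProductProperty T U S := by
  intro t ht u hu s hs e
  have e' : s * t * u = 1 := by
    have h1 : t * u = s⁻¹ := eq_inv_of_mul_eq_one_left e
    rw [mul_assoc, h1, mul_inv_cancel]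
  obtain ⟨h1, h2, h3⟩ := h s hs t ht u hu e'
  exact ⟨h2, h3, h1⟩

/-- Neumann's inequality `|S| (|T| + |U| - 1) ≤ |G|` for a triple with the triple product
property, with `T` and `U` nonempty. -/
theorem TripleProductProperty.card_mul_le {G : Type*} [Group G] [Fintype G] {S T U : Set G}
    (h : TripleProductProperty S T U) (hT : T.Nonempty) (hU : U.Nonempty) :
    S.ncard * (T.ncard + (U.ncard - 1)) ≤ Fintype.card G := by
  obtain ⟨t₀, ht₀⟩ := hT
  obtain ⟨u₀, hu₀⟩ := hU
  have key : ∀ s ∈ S, ∀ s' ∈ S, ∀ t ∈ T, ∀ t' ∈ T, ∀ u ∈ U, ∀ u' ∈ U,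
      s' * s⁻¹ * (t * t'⁻¹) * (u * u'⁻¹) = 1 → s' = s ∧ t = t' ∧ u = u' := by
    intro s hs s' hs' t ht t' ht' u hu u' hu' e
    obtain ⟨h1, h2, h3⟩ := h _ ⟨s', hs', s, hs, rfl⟩ _ ⟨t, ht, t', ht', rfl⟩ _
      ⟨u, hu, u', hu', rfl⟩ e
    exact ⟨mul_inv_eq_one.1 h1, mul_inv_eq_one.1 h2, mul_inv_eq_one.1 h3⟩
  let f : (S × T) ⊕ (S × (U \ {u₀} : Set G)) → G :=
    Sum.elim (fun p => (p.1 : G)⁻¹ * (p.2 * t₀⁻¹)) (fun p => (p.1 : G)⁻¹ * (p.2 * u₀⁻¹))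
  have hf : Function.Injective f := by
    refine Function.Injective.sumElim ?_ ?_ ?_
    · rintro ⟨⟨s, hs⟩, ⟨t, ht⟩⟩ ⟨⟨s', hs'⟩, ⟨t', ht'⟩⟩ e
      have e' : s⁻¹ * t = s'⁻¹ * t' := by simpa [← mul_assoc] using e
      obtain ⟨h1, h2, -⟩ := key s hs s' hs' t ht t' ht' u₀ hu₀ u₀ hu₀ (by
        rw [mul_assoc s', ← mul_assoc s⁻¹, e']; group)
      simp [h1, h2]
    · rintro ⟨⟨s, hs⟩, ⟨u, hu⟩⟩ ⟨⟨s', hs'⟩, ⟨u', hu'⟩⟩ e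
      have e' : s⁻¹ * u = s'⁻¹ * u' := by simpa [← mul_assoc] using e
      obtain ⟨h1, -, h2⟩ := key s hs s' hs' t₀ ht₀ t₀ ht₀ u hu.1 u' hu'.1 (by
        rw [mul_inv_cancel, mul_one, mul_assoc s', ← mul_assoc s⁻¹, e']; group)
      simp [h1, h2]
    · rintro ⟨⟨s, hs⟩, ⟨t, ht⟩⟩ ⟨⟨s', hs'⟩, ⟨u, hu⟩⟩ e
      have e' : s⁻¹ * (t * t₀⁻¹) = s'⁻¹ * (u * u₀⁻¹) := e
      obtain ⟨-, -, h2⟩ := key s hs s' hs' t ht t₀ ht₀ u₀ hu₀ u hu.1 (by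
        rw [mul_assoc s', e']; group)
      exact hu.2 h2.symm
  have hc := Nat.card_le_card_of_injective f hf
  rw [Nat.card_sum, Nat.card_prod, Nat.card_prod, Nat.card_coe_set_eq, Nat.card_coe_set_eq,
    Nat.card_coe_set_eq, Set.ncard_sdiff_singleton_of_mem hu₀, Nat.card_eq_fintype_card,
    ← mul_add] at hc
  exact hc

theorem mul_mul_le_of_mul_add_sub_one_le {n s t u : ℝ} (hs : 0 ≤ s) (hu : 1 ≤ u)
    (hst : s ≤ t) (h₁ : s * (t + (u - 1)) ≤ n) (htu : t * u ≤ n) :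
    s * t * u ≤ n ^ ((3 : ℝ) / 2) / √2 + n := by
  have ht : 0 ≤ t := hs.trans hst
  have hn : 0 ≤ n := (mul_nonneg ht (by linarith)).trans htu
  have hpow : n ^ ((3 : ℝ) / 2) = n * √n := by
    rw [Real.sqrt_eq_rpow, show (3 : ℝ) / 2 = 1 + 1 / 2 by norm_num,
      Real.rpow_add_of_nonneg hn (by norm_num) (by norm_num), Real.rpow_one]
  have hr := Real.sqrt_nonneg n
  have hr2 := Real.sq_sqrt hn
  have hsr : s ≤ √n := Real.le_sqrt_of_sq_le (by nlinarith)
  have hp := Real.sqrt_nonneg (t * u)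
  have hp2 : √(t * u) ^ 2 = t * u := Real.sq_sqrt (mul_nonneg ht (by linarith))
  have hpr : √(t * u) ≤ √n := Real.sqrt_le_sqrt htu
  have hamgm : 2 * √(t * u) ≤ t + u :=
    abs_le_of_sq_le_sq' (by nlinarith [sq_nonneg (t - u)]) (by linarith) |>.2
  have h₂ : s * (2 * √(t * u)) ≤ n + s := by
    nlinarith [mul_le_mul_of_nonneg_left hamgm hs]
  have h₃ : 2 * (s * t * u) ≤ √n * (n + √n) := calc
    2 * (s * t * u) = √(t * u) * (s * (2 * √(t * u))) := by
      linear_combination (-2 * s) * hp2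
    _ ≤ √(t * u) * (n + √n) := by gcongr; linarith
    _ ≤ √n * (n + √n) := by gcongr
  have h₄ : n * √n / 2 ≤ n * √n / √2 :=
    div_le_div_of_nonneg_left (by positivity) (by positivity)
      (Real.sqrt_le_iff.2 ⟨by norm_num, by norm_num⟩)
  rw [hpow]
  nlinarith

theorem TripleProductProperty.card_mul_card_mul_card_le {G : Type*} [Group G] [Fintype G]
    {S T U : Set G} (h : TripleProductProperty S T U)
    (hS : S.Nonempty) (hT : T.Nonempty) (hU : U.Nonempty) (hST : S.ncard ≤ T.ncard) :
    (S.ncard : ℝ) * T.ncard * U.ncard ≤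
      (Fintype.card G : ℝ) ^ ((3 : ℝ) / 2) / Real.sqrt 2 + Fintype.card G := by
  have hu : 1 ≤ U.ncard := hU.ncard_pos
  have h₁ := h.card_mul_le hT hU
  have h₂ : T.ncard * U.ncard ≤ Fintype.card G :=
    (Nat.mul_le_mul_left _ (Nat.le_add_right _ _)).trans (h.rotate_s1.card_mul_le hU hS)
  refine mul_mul_le_of_mul_add_sub_one_le (Nat.cast_nonneg _) (by exact_mod_cast hu)
    (by exact_mod_cast hST) ?_ (by exact_mod_cast h₂)
  have h₃ : ((S.ncard * (T.ncard + (U.ncard - 1)) : ℕ) : ℝ) ≤ Fintype.card G := by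
    exact_mod_cast h₁
  simpa [Nat.cast_sub hu] using h₃

theorem stmt_1 {G : Type*} [Group G] [Fintype G]
    (S T U : Set G) (h : TripleProductProperty S T U) :
    (S.ncard : ℝ) * T.ncard * U.ncard ≤
      (Fintype.card G : ℝ) ^ ((3 : ℝ) / 2) / Real.sqrt 2 + Fintype.card G := by
  have hnn : 0 ≤ (Fintype.card G : ℝ) ^ ((3 : ℝ) / 2) / Real.sqrt 2 + Fintype.card G := by
    positivity
  rcases S.eq_empty_or_nonempty with rfl | hS
  · simpa using hnn
  rcases T.eq_empty_or_nonempty with rfl | hT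
  · simpa using hnn
  rcases U.eq_empty_or_nonempty with rfl | hU
  · simpa using hnn
  by_cases hST : S.ncard ≤ T.ncard
  · exact h.card_mul_card_mul_card_le hS hT hU hST
  by_cases hTU : T.ncard ≤ U.ncard
  · convert h.rotate_s1.card_mul_card_mul_card_le hT hU hS hTU using 1
    ring
  · convert h.rotate_s1.rotate_s1.card_mul_card_mul_card_le hU hS hT (by omega) using 1
    ring
end

section
/- Let G be a finite group and let H₁, H₂, H₃ be subgroups of G satisfying the triple product property. Then |H₁|·|H₂|·|H₃| ≤ |G|^{3/2} / |Z(G)|^{1/2}, where Z(G) is the center of G. -/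
namespace Subgroup

variable {G : Type*} [Group G]

theorem card_mul_card_le_card_mul_card_inf [Finite G] (H K : Subgroup G) :
    Nat.card H * Nat.card K ≤ Nat.card G * Nat.card (H ⊓ K : Subgroup G) := by
  have h₁ := card_mul_index H
  have h₂ : Nat.card (H ⊓ K : Subgroup G) * H.relIndex K = Nat.card K := by
    rw [← inf_relIndex_right H K, ← relIndex_bot_left, ← relIndex_bot_left]
    exact relIndex_mul_relIndex _ _ _ bot_le inf_le_right
  have h₃ : H.relIndex K ≤ H.index := by
    rw [← relIndex_top_right]
    exact relIndex_le_of_le_right le_top (by simp [index_ne_zero_of_finite])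
  rw [← h₁, ← h₂]
  calc Nat.card H * (Nat.card (H ⊓ K : Subgroup G) * H.relIndex K)
      = Nat.card H * H.relIndex K * Nat.card (H ⊓ K : Subgroup G) := by ring
    _ ≤ _ := by gcongr

/-- The central elements lying in the product set `H * K`. -/
def centerInfMul (H K : Subgroup G) : Subgroup (center G) where
  carrier := {z | ∃ a ∈ H, ∃ b ∈ K, (z : G) = a * b}
  one_mem' := ⟨1, H.one_mem, 1, K.one_mem, by simp⟩
  mul_mem' := by
    rintro z w ⟨a, ha, b, hb, hz⟩ ⟨c, hc, d, hd, hw⟩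
    refine ⟨a * c, H.mul_mem ha hc, d * b, K.mul_mem hd hb, ?_⟩
    rw [coe_mul, hz, mul_assoc, mem_center_iff.1 w.2 b, hw]
    group
  inv_mem' := by
    rintro z ⟨a, ha, b, hb, hz⟩
    refine ⟨a⁻¹, H.inv_mem ha, b⁻¹, K.inv_mem hb, ?_⟩
    rw [← mul_inv_rev, coe_inv, inv_inj]
    have h : a⁻¹ * (z : G) = b := by rw [hz]; group
    rw [mem_center_iff.1 z.2 a⁻¹] at h
    rw [← h]; group

theorem mem_centerInfMul {H K : Subgroup G} {z : center G} :
    z ∈ centerInfMul H K ↔ ∃ a ∈ H, ∃ b ∈ K, (z : G) = a * b :=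
  Iff.rfl

theorem card_mul_card_mul_card_center_le [Finite G] {H K : Subgroup G} (hHK : Disjoint H K) :
    Nat.card H * Nat.card K * Nat.card (center G) ≤
      Nat.card G * Nat.card (centerInfMul H K) := by
  let f : H × K × center G → G := fun p ↦ p.1 * p.2.1 * p.2.2
  choose r hr using fun y : Set.range f ↦ y.2
  have hmem (p q : H × K × center G) (hpq : f q = f p) :
      p.2.2 * q.2.2⁻¹ ∈ centerInfMul H K := by
    refine ⟨(p.1 : G)⁻¹ * q.1, H.mul_mem (H.inv_mem p.1.2) q.1.2,
      q.2.1 * (p.2.1 : G)⁻¹, K.mul_mem q.2.1.2 (K.inv_mem p.2.1.2), ?_⟩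
    have h : (q.1 * q.2.1 : G) = p.1 * p.2.1 * (p.2.2 * q.2.2⁻¹ : center G) := by
      rw [coe_mul, ← mul_assoc, coe_inv]
      exact eq_mul_inv_of_mul_eq hpq
    calc ((p.2.2 * q.2.2⁻¹ : center G) : G)
        = (p.1 : G)⁻¹ * (p.1 * p.2.1 * (p.2.2 * q.2.2⁻¹ : center G)) * (p.2.1 : G)⁻¹ := by
          rw [mul_assoc (p.1 : G), mem_center_iff.1 (p.2.2 * q.2.2⁻¹).2 (p.2.1 : G)]
          group
      _ = _ := by rw [← h]; group
  let F : H × K × center G → G × centerInfMul H K := fun p ↦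
    (f p, ⟨p.2.2 * (r ⟨f p, p, rfl⟩).2.2⁻¹, hmem p _ (hr ⟨f p, p, rfl⟩)⟩)
  have hF : Function.Injective F := by
    intro p q hpq
    have hfst : f p = f q := congrArg Prod.fst hpq
    have hr' : r ⟨f p, p, rfl⟩ = r ⟨f q, q, rfl⟩ := by congr 1; exact Subtype.ext hfst
    have hsnd := congrArg Subtype.val (congrArg Prod.snd hpq)
    simp only [F, hr'] at hsnd
    have hz : p.2.2 = q.2.2 := mul_right_cancel hsnd
    have hab : (p.1 * p.2.1 : G) = q.1 * q.2.1 := by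
      simp only [f, hz] at hfst
      exact mul_right_cancel hfst
    have hinj := mul_injective_of_disjoint hHK (a₁ := (p.1, p.2.1)) (a₂ := (q.1, q.2.1)) hab
    rw [Prod.mk.injEq] at hinj
    exact Prod.ext hinj.1 (Prod.ext hinj.2 hz)
  have hcard := Nat.card_le_card_of_injective F hF
  simpa only [Nat.card_prod, mul_assoc] using hcard

end Subgroup

namespace TripleProductProperty

open Subgroup

variable {G : Type*} [Group G] {H₁ H₂ H₃ : Subgroup G}

theorem eq_one_of_mul_eq_one
    (h : TripleProductProperty (H₁ : Set G) (H₂ : Set G) (H₃ : Set G))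
    {a b c : G} (ha : a ∈ H₁) (hb : b ∈ H₂) (hc : c ∈ H₃) (habc : a * b * c = 1) :
    a = 1 ∧ b = 1 ∧ c = 1 :=
  h a ⟨a, ha, 1, H₁.one_mem, by simp⟩ b ⟨b, hb, 1, H₂.one_mem, by simp⟩
    c ⟨c, hc, 1, H₃.one_mem, by simp⟩ habc

theorem disjoint₁₂ (h : TripleProductProperty (H₁ : Set G) (H₂ : Set G) (H₃ : Set G)) :
    Disjoint H₁ H₂ :=
  disjoint_def.2 fun hx hy ↦
    (h.eq_one_of_mul_eq_one hx (H₂.inv_mem hy) H₃.one_mem (by simp)).1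

theorem disjoint₂₃ (h : TripleProductProperty (H₁ : Set G) (H₂ : Set G) (H₃ : Set G)) :
    Disjoint H₂ H₃ :=
  disjoint_def.2 fun hx hy ↦
    (h.eq_one_of_mul_eq_one H₁.one_mem hx (H₃.inv_mem hy) (by simp)).2.1

theorem disjoint₁₃ (h : TripleProductProperty (H₁ : Set G) (H₂ : Set G) (H₃ : Set G)) :
    Disjoint H₁ H₃ :=
  disjoint_def.2 fun hx hy ↦
    (h.eq_one_of_mul_eq_one hx H₂.one_mem (H₃.inv_mem hy) (by simp)).1

theorem inf_centerInfMul_eq_bot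
    (h : TripleProductProperty (H₁ : Set G) (H₂ : Set G) (H₃ : Set G)) :
    centerInfMul H₁ H₂ ⊓ centerInfMul H₂ H₃ ⊓ centerInfMul H₁ H₃ = ⊥ := by
  refine (eq_bot_iff_forall _).2 ?_
  rintro z ⟨⟨⟨a, ha, b, hb, hab⟩, ⟨b', hb', c, hc, hbc⟩⟩, ⟨a', ha', c', hc', hac⟩⟩
  have hz : (z : G) = b' := by
    have h₁ : a = b⁻¹ * z := by rw [mem_center_iff.1 z.2 b⁻¹, hab]; group
    have h₂ : a⁻¹ * (b⁻¹ * b') * c = 1 := by rw [h₁, hbc]; group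
    have := (h.eq_one_of_mul_eq_one (H₁.inv_mem ha)
      (H₂.mul_mem (H₂.inv_mem hb) hb') hc h₂).2.2
    rw [hbc, this, mul_one]
  have h₃ : a'⁻¹ * b' * c'⁻¹ = 1 := by rw [← hz, hac]; group
  have := (h.eq_one_of_mul_eq_one (H₁.inv_mem ha') hb' (H₃.inv_mem hc') h₃).2.1
  exact Subtype.ext (hz.trans this)

theorem card_sq_mul_card_center_le [Finite G]
    (h : TripleProductProperty (H₁ : Set G) (H₂ : Set G) (H₃ : Set G)) :
    (Nat.card H₁ * Nat.card H₂ * Nat.card H₃) ^ 2 * Nat.card (center G) ≤ Nat.card G ^ 3 := by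
  have h₁₂ := card_mul_card_mul_card_center_le h.disjoint₁₂
  have h₂₃ := card_mul_card_mul_card_center_le h.disjoint₂₃
  have h₁₃ := card_mul_card_mul_card_center_le h.disjoint₁₃
  have hA := card_mul_card_le_card_mul_card_inf (centerInfMul H₁ H₂) (centerInfMul H₂ H₃)
  have hB := card_mul_card_le_card_mul_card_inf
    (centerInfMul H₁ H₂ ⊓ centerInfMul H₂ H₃) (centerInfMul H₁ H₃)
  rw [h.inf_centerInfMul_eq_bot, card_bot, mul_one] at hB
  have hZ : 0 < Nat.card (center G) := Nat.card_pos
  set x := Nat.card (centerInfMul H₁ H₂)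
  set y := Nat.card (centerInfMul H₂ H₃)
  set w := Nat.card (centerInfMul H₁ H₃)
  set v := Nat.card (centerInfMul H₁ H₂ ⊓ centerInfMul H₂ H₃ : Subgroup (center G))
  set m := Nat.card (center G)
  set n := Nat.card G
  refine Nat.le_of_mul_le_mul_right ?_ (pow_pos hZ 2)
  calc (Nat.card H₁ * Nat.card H₂ * Nat.card H₃) ^ 2 * m * m ^ 2
      = (Nat.card H₁ * Nat.card H₂ * m) * (Nat.card H₂ * Nat.card H₃ * m) *
          (Nat.card H₁ * Nat.card H₃ * m) := by ring
    _ ≤ (n * x) * (n * y) * (n * w) := by gcongr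
    _ = n ^ 3 * (x * y * w) := by ring
    _ ≤ n ^ 3 * (m * v * w) := by gcongr
    _ = n ^ 3 * (m * (v * w)) := by ring
    _ ≤ n ^ 3 * (m * m) := by gcongr
    _ = n ^ 3 * m ^ 2 := by ring

end TripleProductProperty

theorem stmt_4 {G : Type*} [Group G] [Fintype G]
    (H₁ H₂ H₃ : Subgroup G)
    (h : TripleProductProperty (H₁ : Set G) (H₂ : Set G) (H₃ : Set G)) :
    (Nat.card H₁ : ℝ) * Nat.card H₂ * Nat.card H₃ ≤
      (Nat.card G : ℝ) ^ ((3 : ℝ) / 2) /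
        (Nat.card (Subgroup.center G) : ℝ) ^ ((1 : ℝ) / 2) := by
  have hZ : (0 : ℝ) < Nat.card (Subgroup.center G) := by exact_mod_cast Nat.card_pos
  have key : ((Nat.card H₁ : ℝ) * Nat.card H₂ * Nat.card H₃) ^ 2 *
      Nat.card (Subgroup.center G) ≤ (Nat.card G : ℝ) ^ 3 := by
    exact_mod_cast h.card_sq_mul_card_center_le
  rw [le_div_iff₀ (by positivity)]
  refine le_of_sq_le_sq ?_ (by positivity)
  rw [mul_pow, ← Real.rpow_mul_natCast hZ.le, ← Real.rpow_mul_natCast (Nat.cast_nonneg _)]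
  norm_num only [Nat.cast_ofNat, Real.rpow_one]
  exact_mod_cast key
end

section
/- Let G be a finite group and let S, T, U be subsets of G satisfying the triple product property. Then (|S|·|T|·|U|)² ≤ |G|³, i.e., |S|·|T|·|U| ≤ |G|^{3/2}. -/
theorem one_mem_quotientSet {G : Type*} [Group G] {X : Set G} (hX : X.Nonempty) :
    1 ∈ quotientSet X := by
  obtain ⟨x, hx⟩ := hX
  exact ⟨x, hx, x, hx, (mul_inv_cancel x).symm⟩

/-- If the quotient sets of `X` and `Y` are independent, then `(x, y) ↦ x⁻¹ * y` is injective on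
`X ×ˢ Y`, so `|X| * |Y| ≤ |G|`. -/
theorem ncard_mul_ncard_le_card {G : Type*} [Group G] [Fintype G] {X Y : Set G}
    (h : ∀ x ∈ quotientSet X, ∀ y ∈ quotientSet Y, x * y = 1 → x = 1 ∧ y = 1) :
    X.ncard * Y.ncard ≤ Fintype.card G := by
  rw [← Set.ncard_prod, ← Nat.card_eq_fintype_card, ← Set.ncard_univ]
  refine Set.ncard_le_ncard_of_injOn (fun p : G × G => p.1⁻¹ * p.2)
    (fun _ _ => Set.mem_univ _) ?_ Set.finite_univ
  rintro ⟨x, y⟩ ⟨hx, hy⟩ ⟨x', y'⟩ ⟨hx', hy'⟩ hxy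
  have hxy' : x⁻¹ * y = x'⁻¹ * y' := hxy
  have key : x' * x⁻¹ * (y * y'⁻¹) = 1 := by
    calc x' * x⁻¹ * (y * y'⁻¹) = x' * (x⁻¹ * y) * y'⁻¹ := by group
      _ = 1 := by rw [hxy']; group
  obtain ⟨h₁, h₂⟩ := h _ ⟨x', hx', x, hx, rfl⟩ _ ⟨y, hy, y', hy', rfl⟩ key
  exact Prod.ext (mul_inv_eq_one.mp h₁).symm (mul_inv_eq_one.mp h₂)

theorem stmt_8 {G : Type*} [Group G] [Fintype G]
    (S T U : Set G) (h : TripleProductProperty S T U) :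
    (S.ncard * T.ncard * U.ncard) ^ 2 ≤ Fintype.card G ^ 3 := by
  rcases S.eq_empty_or_nonempty with rfl | hS
  · simp
  rcases T.eq_empty_or_nonempty with rfl | hT
  · simp
  rcases U.eq_empty_or_nonempty with rfl | hU
  · simp
  have hST : S.ncard * T.ncard ≤ Fintype.card G :=
    ncard_mul_ncard_le_card fun s hs t ht hst =>
      have hstu := h s hs t ht 1 (one_mem_quotientSet hU) (by rw [mul_one, hst])
      ⟨hstu.1, hstu.2.1⟩
  have hTU : T.ncard * U.ncard ≤ Fintype.card G :=
    ncard_mul_ncard_le_card fun t ht u hu htu =>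
      (h 1 (one_mem_quotientSet hS) t ht u hu (by rw [one_mul, htu])).2
  have hSU : S.ncard * U.ncard ≤ Fintype.card G :=
    ncard_mul_ncard_le_card fun s hs u hu hsu =>
      have hstu := h s hs 1 (one_mem_quotientSet hT) u hu (by rw [mul_one, hsu])
      ⟨hstu.1, hstu.2.2⟩
  calc (S.ncard * T.ncard * U.ncard) ^ 2
      = S.ncard * T.ncard * (T.ncard * U.ncard) * (S.ncard * U.ncard) := by ring
    _ ≤ Fintype.card G * Fintype.card G * Fintype.card G := by gcongr
    _ = Fintype.card G ^ 3 := by ring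
end

section
/- Let G be a finite abelian group and let S, T, U be subsets of G satisfying the triple product property. Then |S|·|T|·|U| ≤ |G|. -/
/-- In a commutative group, multiplication is injective on the product of three sets with the
triple product property. -/
theorem TripleProductProperty.injOn_mul {G : Type*} [CommGroup G] {S T U : Set G}
    (h : TripleProductProperty S T U) :
    Set.InjOn (fun p : (G × G) × G => p.1.1 * p.1.2 * p.2) ((S ×ˢ T) ×ˢ U) := by
  rintro ⟨⟨s, t⟩, u⟩ ⟨⟨hs, ht⟩, hu⟩ ⟨⟨s', t'⟩, u'⟩ ⟨⟨hs', ht'⟩, hu'⟩ heq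
  have hprod : s * s'⁻¹ * (t * t'⁻¹) * (u * u'⁻¹) = 1 := by
    calc s * s'⁻¹ * (t * t'⁻¹) * (u * u'⁻¹) = s * t * u / (s' * t' * u') := by
          simp only [div_eq_mul_inv, mul_inv]
          ac_rfl
      _ = 1 := div_eq_one.mpr heq
  obtain ⟨h₁, h₂, h₃⟩ := h _ ⟨s, hs, s', hs', rfl⟩ _ ⟨t, ht, t', ht', rfl⟩ _
    ⟨u, hu, u', hu', rfl⟩ hprod
  rw [mul_inv_eq_one] at h₁ h₂ h₃
  rw [h₁, h₂, h₃]

theorem stmt_10 {G : Type*} [CommGroup G] [Fintype G]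
    (S T U : Set G) (h : TripleProductProperty S T U) :
    S.ncard * T.ncard * U.ncard ≤ Fintype.card G := by
  rw [← Set.ncard_prod, ← Set.ncard_prod, ← h.injOn_mul.ncard_image, ← Nat.card_eq_fintype_card]
  exact Set.ncard_le_card _
end

section
/- Let G be a finite group and let S, T, U be subsets of G satisfying the triple product property. Then for every complex irreducible unitary representation π of G with dim π > 1, the Frobenius norm of Σ_{g ∈ S⁻¹T} π(g) satisfies ‖Σ_{g ∈ S⁻¹T} π(g)‖² ≤ |S|·|T|·|G| / n(G), where S⁻¹T = {s⁻¹t : s ∈ S, t ∈ T}. -/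
open Matrix in
/-- Schur's lemma for matrix representations. -/
theorem exists_eq_smul_one_of_commute {G ι : Type*} [Group G] [Fintype ι] [DecidableEq ι]
    [Nonempty ι] (π : G →* unitaryGroup ι ℂ)
    (hirr : ∀ W : Submodule ℂ (ι → ℂ),
      (∀ g : G, ∀ w ∈ W, (π g : Matrix ι ι ℂ) *ᵥ w ∈ W) → W = ⊥ ∨ W = ⊤)
    (M : Matrix ι ι ℂ) (hM : ∀ g, M * (π g : Matrix ι ι ℂ) = (π g : Matrix ι ι ℂ) * M) :
    ∃ c : ℂ, M = c • (1 : Matrix ι ι ℂ) := by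
  obtain ⟨c, hc⟩ := Module.End.exists_eigenvalue (toLin' M)
  refine ⟨c, ?_⟩
  have htop : Module.End.eigenspace (toLin' M) c = ⊤ := by
    refine (hirr _ fun g w hw ↦ ?_).resolve_left hc
    rw [Module.End.mem_eigenspace_iff, toLin'_apply] at hw ⊢
    rw [mulVec_mulVec, hM, ← mulVec_mulVec, hw, mulVec_smul]
  refine toLin'.injective (LinearMap.ext fun v ↦ ?_)
  have hv : v ∈ Module.End.eigenspace (toLin' M) c := htop ▸ Submodule.mem_top
  rw [Module.End.mem_eigenspace_iff] at hv
  simp [hv]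

open Matrix in
/-- Averaging a matrix over an irreducible unitary representation gives a scalar matrix. -/
theorem sum_conj_eq_smul_one {G ι : Type*} [Group G] [Fintype G] [Fintype ι] [DecidableEq ι]
    [Nonempty ι] (π : G →* unitaryGroup ι ℂ)
    (hirr : ∀ W : Submodule ℂ (ι → ℂ),
      (∀ g : G, ∀ w ∈ W, (π g : Matrix ι ι ℂ) *ᵥ w ∈ W) → W = ⊥ ∨ W = ⊤)
    (B : Matrix ι ι ℂ) :
    ∑ g, (π g : Matrix ι ι ℂ) * B * star (π g : Matrix ι ι ℂ) =
      (Fintype.card G * B.trace / Fintype.card ι : ℂ) • (1 : Matrix ι ι ℂ) := by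
  have hU (g : G) : star (π g : Matrix ι ι ℂ) * (π g : Matrix ι ι ℂ) = 1 :=
    UnitaryGroup.star_mul_self _
  obtain ⟨c, hc⟩ := exists_eq_smul_one_of_commute π hirr
    (∑ g, (π g : Matrix ι ι ℂ) * B * star (π g : Matrix ι ι ℂ)) fun h ↦ by
      rw [Finset.sum_mul, Finset.mul_sum, ← Equiv.sum_comp (Equiv.mulLeft h)]
      refine Finset.sum_congr rfl fun g _ ↦ ?_
      simp only [Equiv.coe_mulLeft, map_mul, UnitaryGroup.mul_val, star_mul, mul_assoc, hU,
        mul_one]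
  have htr := congrArg trace hc
  simp only [trace_sum, trace_smul, trace_one, smul_eq_mul] at htr
  have htr' (g : G) :
      ((π g : Matrix ι ι ℂ) * B * star (π g : Matrix ι ι ℂ)).trace = B.trace := by
    rw [trace_mul_comm, ← mul_assoc, hU, one_mul]
  simp only [htr', Finset.sum_const, Finset.card_univ, nsmul_eq_mul] at htr
  rw [hc, htr, mul_div_cancel_right₀ _ (by simp)]

open Matrix in
/-- Schur orthogonality for the matrix coefficients of an irreducible unitary representation. -/
theorem sum_coeff_mul_star_coeff {G ι : Type*} [Group G] [Fintype G] [Fintype ι] [DecidableEq ι]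
    [Nonempty ι] (π : G →* unitaryGroup ι ℂ)
    (hirr : ∀ W : Submodule ℂ (ι → ℂ),
      (∀ g : G, ∀ w ∈ W, (π g : Matrix ι ι ℂ) *ᵥ w ∈ W) → W = ⊥ ∨ W = ⊤)
    (i k j l : ι) :
    ∑ g, (π g : Matrix ι ι ℂ) i k * star ((π g : Matrix ι ι ℂ) j l) =
      if i = j then (if k = l then (Fintype.card G / Fintype.card ι : ℂ) else 0) else 0 := by
  have h := congrFun (congrFun (sum_conj_eq_smul_one π hirr (single k l 1)) i) j
  rw [Matrix.sum_apply] at h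
  have hg (g : G) : ((π g : Matrix ι ι ℂ) * single k l 1 * star (π g : Matrix ι ι ℂ) :
      Matrix ι ι ℂ) i j =
      (π g : Matrix ι ι ℂ) i k * star ((π g : Matrix ι ι ℂ) j l) := by
    rw [mul_apply, Finset.sum_eq_single l]
    · simp [star_apply]
    · intro b _ hb
      simp [hb]
    · simp
  simp only [hg] at h
  rw [h]
  by_cases hij : i = j <;> by_cases hkl : k = l <;> simp [hij, hkl, one_apply]

open Matrix in
/-- Every coefficient functional `g ↦ ∑ i j, conj (A i j) * π g i j` has squared `ℓ²` norm
`|G| / dim π` times that of `A`. -/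
theorem sum_norm_sq_pairing {G ι : Type*} [Group G] [Fintype G] [Fintype ι] [DecidableEq ι]
    [Nonempty ι] (π : G →* unitaryGroup ι ℂ)
    (hirr : ∀ W : Submodule ℂ (ι → ℂ),
      (∀ g : G, ∀ w ∈ W, (π g : Matrix ι ι ℂ) *ᵥ w ∈ W) → W = ⊥ ∨ W = ⊤)
    (A : Matrix ι ι ℂ) :
    ∑ g, ‖∑ i, ∑ j, star (A i j) * (π g : Matrix ι ι ℂ) i j‖ ^ 2 =
      (Fintype.card G / Fintype.card ι : ℝ) * ∑ i, ∑ j, ‖A i j‖ ^ 2 := by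
  have hsq (z : ℂ) : ((‖z‖ ^ 2 : ℝ) : ℂ) = z * star z := by
    rw [Complex.star_def, Complex.mul_conj, Complex.normSq_eq_norm_sq]
  apply Complex.ofReal_injective
  rw [Complex.ofReal_mul]
  simp only [Complex.ofReal_sum, hsq]
  simp only [← Finset.univ_product_univ, ← Fintype.sum_prod_type']
  simp only [star_sum, Finset.sum_mul_sum, star_mul', star_star]
  rw [Finset.sum_comm, Finset.mul_sum]
  refine Finset.sum_congr rfl fun p _ ↦ ?_
  rw [Finset.sum_comm]
  have hterm (q : ι × ι) : ∑ g, star (A p.1 p.2) * (π g : Matrix ι ι ℂ) p.1 p.2 *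
      (A q.1 q.2 * star ((π g : Matrix ι ι ℂ) q.1 q.2)) =
      star (A p.1 p.2) * A q.1 q.2 *
        (if p = q then (Fintype.card G / Fintype.card ι : ℂ) else 0) := by
    have h := sum_coeff_mul_star_coeff π hirr p.1 p.2 q.1 q.2
    have hpq : (if p = q then (Fintype.card G / Fintype.card ι : ℂ) else 0) =
        if p.1 = q.1 then (if p.2 = q.2 then (Fintype.card G / Fintype.card ι : ℂ) else 0)
          else 0 := by
      simp only [Prod.ext_iff, ite_and]
    rw [hpq, ← h, Finset.mul_sum]
    exact Finset.sum_congr rfl fun g _ ↦ by ring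
  simp only [hterm, mul_ite, mul_zero, Finset.sum_ite_eq, Finset.univ_product_univ,
    Finset.mem_univ, if_true]
  push_cast
  ring

open Matrix in
/-- Bessel's inequality for the Fourier coefficient of an indicator function at an irreducible
unitary representation. -/
theorem norm_sq_sum_le_card_mul_card_div {G ι : Type*} [Group G] [Fintype G] [Fintype ι]
    [DecidableEq ι] [Nonempty ι] (π : G →* unitaryGroup ι ℂ)
    (hirr : ∀ W : Submodule ℂ (ι → ℂ),
      (∀ g : G, ∀ w ∈ W, (π g : Matrix ι ι ℂ) *ᵥ w ∈ W) → W = ⊥ ∨ W = ⊤)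
    (X : Finset G) :
    ∑ i, ∑ j, ‖(∑ g ∈ X, (π g : Matrix ι ι ℂ)) i j‖ ^ 2 ≤
      (X.card : ℝ) * Fintype.card G / Fintype.card ι := by
  set A : Matrix ι ι ℂ := ∑ g ∈ X, (π g : Matrix ι ι ℂ) with hA
  set N : ℝ := ∑ i, ∑ j, ‖A i j‖ ^ 2 with hN
  set f : G → ℂ := fun g ↦ ∑ i, ∑ j, star (A i j) * (π g : Matrix ι ι ℂ) i j with hf
  have hN0 : 0 ≤ N := by positivity
  have hfN : ∑ g ∈ X, f g = (N : ℂ) := by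
    simp only [hf, hN, Complex.ofReal_sum]
    rw [Finset.sum_comm]
    refine Finset.sum_congr rfl fun i _ ↦ ?_
    rw [Finset.sum_comm]
    refine Finset.sum_congr rfl fun j _ ↦ ?_
    rw [← Finset.mul_sum, ← Matrix.sum_apply i j X (fun g ↦ (π g : Matrix ι ι ℂ)), ← hA, mul_comm,
      Complex.star_def, Complex.mul_conj, Complex.normSq_eq_norm_sq]
  have hle : N ≤ ∑ g ∈ X, ‖f g‖ := by
    calc N = ‖∑ g ∈ X, f g‖ := by rw [hfN, Complex.norm_real, Real.norm_of_nonneg hN0]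
      _ ≤ _ := norm_sum_le _ _
  have hsq : N ^ 2 ≤ X.card * (Fintype.card G / Fintype.card ι * N) := by
    calc N ^ 2 ≤ (∑ g ∈ X, ‖f g‖) ^ 2 := by gcongr
      _ ≤ X.card * ∑ g ∈ X, ‖f g‖ ^ 2 := sq_sum_le_card_mul_sum_sq
      _ ≤ X.card * ∑ g, ‖f g‖ ^ 2 := by
        gcongr
        exact Finset.subset_univ X
      _ = _ := by rw [sum_norm_sq_pairing π hirr A]
  rcases hN0.eq_or_lt with h0 | hpos
  · rw [← h0]
    positivity
  · refine le_of_mul_le_mul_right ?_ hpos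
    calc N * N = N ^ 2 := (sq N).symm
      _ ≤ _ := hsq
      _ = _ := by ring

open Matrix in
/-- The dimension of an irreducible unitary representation of dimension greater than `1` is at
least `n(G)`, which is then positive. -/
theorem minNontrivIrrepDim_pos_and_le {G : Type} [Group G] [Fintype G] (d : ℕ) (hd : 1 < d)
    (π : G →* unitaryGroup (Fin d) ℂ)
    (hirr : ∀ W : Submodule ℂ (Fin d → ℂ),
      (∀ g : G, ∀ w ∈ W, (π g : Matrix (Fin d) (Fin d) ℂ) *ᵥ w ∈ W) → W = ⊥ ∨ W = ⊤) :
    0 < minNontrivIrrepDim G ∧ minNontrivIrrepDim G ≤ d := by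
  have : Nonempty (Fin d) := ⟨⟨0, by omega⟩⟩
  have hd0 : (d : ℂ) ≠ 0 := by
    rw [Nat.cast_ne_zero]
    omega
  let ρ : Representation ℂ G (Fin d → ℂ) :=
    (toLinAlgEquiv' : Matrix (Fin d) (Fin d) ℂ ≃ₐ[ℂ] _).toMonoidHom.comp
      ((unitaryGroup (Fin d) ℂ).subtype.comp π)
  have hχ (g : G) : (FDRep.of ρ).character g = ∑ i, (π g : Matrix (Fin d) (Fin d) ℂ) i i :=
    trace_toLin'_eq _
  have hinv (g : G) (j : Fin d) : (π g⁻¹ : Matrix (Fin d) (Fin d) ℂ) j j =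
      star ((π g : Matrix (Fin d) (Fin d) ℂ) j j) := by
    rw [map_inv]
    rfl
  have hmem : d ∈ {d : ℕ | 1 < d ∧
      ∃ V : FDRep ℂ G, CategoryTheory.Simple V ∧ Module.finrank ℂ V = d} := by
    refine ⟨hd, FDRep.of ρ, ?_, Module.finrank_fin_fun ℂ⟩
    rw [FDRep.simple_iff_char_is_norm_one]
    simp only [hχ, hinv, Finset.sum_mul_sum]
    rw [Finset.sum_comm]
    have hi (i : Fin d) : ∑ g, ∑ j, (π g : Matrix (Fin d) (Fin d) ℂ) i i *
        star ((π g : Matrix (Fin d) (Fin d) ℂ) j j) = (Fintype.card G / d : ℂ) := by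
      rw [Finset.sum_comm]
      simp only [sum_coeff_mul_star_coeff π hirr]
      simp
    simp only [hi]
    simp [mul_div_cancel₀ _ hd0]
  exact ⟨zero_lt_one.trans (Nat.sInf_mem ⟨d, hmem⟩).1, Nat.sInf_le hmem⟩

open scoped Pointwise in
theorem stmt_12 {G : Type} [Group G] [Fintype G]
    (S T U : Set G) (h : TripleProductProperty S T U)
    (d : ℕ) (hd : 1 < d)
    (π : G →* Matrix.unitaryGroup (Fin d) ℂ)
    (hirr : ∀ W : Submodule ℂ (Fin d → ℂ),
      (∀ g : G, ∀ w ∈ W, (π g : Matrix (Fin d) (Fin d) ℂ).mulVec w ∈ W) →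
        W = ⊥ ∨ W = ⊤) :
    ∑ i : Fin d, ∑ j : Fin d,
        ‖(∑ g ∈ (Set.toFinite (S⁻¹ * T)).toFinset, (π g : Matrix (Fin d) (Fin d) ℂ)) i j‖ ^ 2
      ≤ (S.ncard : ℝ) * T.ncard * Fintype.card G / minNontrivIrrepDim G := by
  have : Nonempty (Fin d) := ⟨⟨0, by omega⟩⟩
  obtain ⟨hpos, hle⟩ := minNontrivIrrepDim_pos_and_le d hd π hirr
  have hcard : (Set.toFinite (S⁻¹ * T)).toFinset.card ≤ S.ncard * T.ncard := by
    rw [← Set.ncard_eq_toFinset_card]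
    simpa only [Nat.card_coe_set_eq, Set.ncard_inv] using Set.natCard_mul_le (s := S⁻¹) (t := T)
  refine (norm_sq_sum_le_card_mul_card_div π hirr _).trans ?_
  rw [Fintype.card_fin]
  gcongr
  exact_mod_cast hcard
end

section
/- Let G be a group, let H₁, H₂, H₃ be subgroups of G, and let K be a subgroup of G such that whenever h₁·h₂·h₃ = 1 with hᵢ ∈ Hᵢ, one has h₁, h₂, h₃ ∈ K. Suppose H₂' ⊆ H₂ and H₃' ⊆ H₃ are subsets with the property that for i ∈ {2,3} and any h, h' ∈ Hᵢ', if h·h'⁻¹ ∈ K then h = h'. Then the subsets H₁, H₂', H₃' of G satisfy the triple product property. -/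
theorem stmt_13 {G : Type*} [Group G]
    (H₁ H₂ H₃ K : Subgroup G)
    (hK : ∀ h₁ ∈ H₁, ∀ h₂ ∈ H₂, ∀ h₃ ∈ H₃,
      h₁ * h₂ * h₃ = 1 → h₁ ∈ K ∧ h₂ ∈ K ∧ h₃ ∈ K)
    (H₂' H₃' : Set G) (hH₂' : H₂' ⊆ (H₂ : Set G)) (hH₃' : H₃' ⊆ (H₃ : Set G))
    (hsec₂ : ∀ h ∈ H₂', ∀ h' ∈ H₂', h * h'⁻¹ ∈ K → h = h')
    (hsec₃ : ∀ h ∈ H₃', ∀ h' ∈ H₃', h * h'⁻¹ ∈ K → h = h') :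
    TripleProductProperty (H₁ : Set G) H₂' H₃' := by
  rintro _ ⟨a, ha, a', ha', rfl⟩ _ ⟨b, hb, b', hb', rfl⟩ _ ⟨c, hc, c', hc', rfl⟩ h
  obtain ⟨-, hbK, hcK⟩ := hK _ (H₁.mul_mem ha (H₁.inv_mem ha'))
    _ (H₂.mul_mem (hH₂' hb) (H₂.inv_mem (hH₂' hb')))
    _ (H₃.mul_mem (hH₃' hc) (H₃.inv_mem (hH₃' hc'))) h
  obtain rfl := hsec₂ b hb b' hb' hbK
  obtain rfl := hsec₃ c hc c' hc' hcK
  simpa using h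
end

section
/- Let n ≥ 1, let D₁ = diag(x₁, …, xₙ) with x₁ > x₂ > ⋯ > xₙ > 0, and let D₂ = diag(y₁, …, yₙ) with 0 < y₁ < y₂ < ⋯ < yₙ. Suppose h₁ = D₁·M₁·D₁⁻¹ and h₂ = D₂·M₂·D₂⁻¹ where M₁, M₂ ∈ O(n, ℝ). If h₁ᵀ·h₁ = h₂ᵀ·h₂, then h₁ and h₂ are diagonal matrices with all diagonal entries equal to ±1. -/
open Matrix

/-- If `a` is strictly decreasing and `c` strictly increasing, there is a potential `v` of which
each `a i` is a strict supergradient at `i`, in the variable `c`. -/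
theorem exists_strict_potential {n : ℕ} (a c : Fin n → ℝ) (ha : StrictAnti a)
    (hc : StrictMono c) :
    ∃ v : Fin n → ℝ, ∀ i j, i ≠ j → v j - v i < a i * (c j - c i) := by
  induction n with
  | zero => exact ⟨0, fun i => i.elim0⟩
  | succ n ih =>
    obtain ⟨v, hv⟩ := ih (fun i => a i.castSucc) (fun i => c i.castSucc)
      (fun i j h => ha (Fin.castSucc_lt_castSucc_iff.2 h))
      (fun i j h => hc (Fin.castSucc_lt_castSucc_iff.2 h))
    rcases n with _ | n
    · exact ⟨0, fun i j h => absurd (Subsingleton.elim (α := Fin 1) i j) h⟩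
    set m : Fin (n + 2) := (Fin.last n).castSucc with hm
    have hml : m < Fin.last (n + 1) := Fin.castSucc_lt_last _
    have hal := ha hml
    have hcl := hc hml
    refine ⟨Fin.snoc v (v (Fin.last n) +
      (a m + a (Fin.last (n + 1))) / 2 * (c (Fin.last (n + 1)) - c m)), fun i j hij => ?_⟩
    have key : ∀ i : Fin (n + 1), v (Fin.last n) - v i ≤ a i.castSucc * (c m - c i.castSucc) ∧
        a m * (c i.castSucc - c m) ≥ v i - v (Fin.last n) ∧
        a m ≤ a i.castSucc ∧ c i.castSucc ≤ c m := fun i => by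
      have hle : i.castSucc ≤ m := Fin.castSucc_le_castSucc_iff.2 (Fin.le_last i)
      refine ⟨?_, ?_, ha.antitone hle, hc.monotone hle⟩ <;>
        rcases eq_or_ne i (Fin.last n) with rfl | h
      · simp [hm]
      · exact (hv _ _ h).le
      · simp [hm]
      · exact (hv _ _ h.symm).le
    induction i using Fin.lastCases with
    | last =>
      induction j using Fin.lastCases with
      | last => exact absurd rfl hij
      | cast j =>
        obtain ⟨-, h2, -, h4⟩ := key j
        simp only [Fin.snoc_last, Fin.snoc_castSucc]
        nlinarith [mul_nonneg (sub_nonneg.2 hal.le) (sub_nonneg.2 h4),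
          mul_pos (sub_pos.2 hal) (sub_pos.2 hcl)]
    | cast i =>
      induction j using Fin.lastCases with
      | last =>
        obtain ⟨h1, -, h3, -⟩ := key i
        simp only [Fin.snoc_last, Fin.snoc_castSucc]
        nlinarith [mul_nonneg (sub_nonneg.2 h3) (sub_nonneg.2 hcl.le),
          mul_pos (sub_pos.2 hal) (sub_pos.2 hcl)]
      | cast j =>
        simpa only [Fin.snoc_castSucc] using hv i j fun h => hij (h ▸ rfl)

/-- Equality case of the rearrangement inequality for doubly stochastic matrices. -/
theorem eq_zero_of_sum_mul_eq {n : ℕ} (a c : Fin n → ℝ) (ha : StrictAnti a)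
    (hc : StrictMono c) (w : Fin n → Fin n → ℝ) (hw : ∀ i j, 0 ≤ w i j)
    (hrow : ∀ i, ∑ j, w i j = 1) (hcol : ∀ j, ∑ i, w i j = 1)
    (h : ∑ j, ∑ i, w i j * (a i * c j) = ∑ j, a j * c j) {i j : Fin n} (hij : i ≠ j) :
    w i j = 0 := by
  obtain ⟨v, hv⟩ := exists_strict_potential a c ha hc
  have hnn : ∀ i j, 0 ≤ w i j * (a i * (c j - c i) - (v j - v i)) := fun i j => by
    rcases eq_or_ne i j with rfl | hne
    · simp
    · exact mul_nonneg (hw i j) (sub_nonneg.2 (hv i j hne).le)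
  have hsum : ∑ j, ∑ i, w i j * (a i * (c j - c i) - (v j - v i)) = 0 := by
    have e : ∀ i j, w i j * (a i * (c j - c i) - (v j - v i)) =
        w i j * (a i * c j) - w i j * (a i * c i - v i) - w i j * v j := fun i j => by ring
    simp only [e, Finset.sum_sub_distrib, h, ← Finset.sum_mul, hcol, one_mul]
    rw [Finset.sum_comm (f := fun j i => w i j * (a i * c i - v i))]
    simp only [← Finset.sum_mul, hrow, one_mul, Finset.sum_sub_distrib]
    ring
  rw [Finset.sum_eq_zero_iff_of_nonneg fun j _ => Finset.sum_nonneg fun i _ => hnn i j] at hsum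
  have hj := hsum j (Finset.mem_univ j)
  rw [Finset.sum_eq_zero_iff_of_nonneg fun i _ => hnn i j] at hj
  exact (mul_eq_zero.1 (hj i (Finset.mem_univ i))).resolve_right
    (sub_pos.2 (hv i j hij)).ne'

theorem sum_sq_col_eq_one {n : ℕ} {M : Matrix (Fin n) (Fin n) ℝ} (hM : Mᵀ * M = 1) (j : Fin n) :
    ∑ i, M i j ^ 2 = 1 := by
  simpa [Matrix.mul_apply, sq] using congrFun (congrFun hM j) j

theorem sum_sq_row_eq_one {n : ℕ} {M : Matrix (Fin n) (Fin n) ℝ} (hM : Mᵀ * M = 1) (i : Fin n) :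
    ∑ j, M i j ^ 2 = 1 := by
  have hM' : M * Mᵀ = 1 := mul_eq_one_comm.1 hM
  simpa [Matrix.mul_apply, sq] using congrFun (congrFun hM' i) i

theorem diagonal_conj_apply {n : ℕ} {x : Fin n → ℝ} (hx : ∀ j, 0 < x j)
    (M : Matrix (Fin n) (Fin n) ℝ) (i j : Fin n) :
    (diagonal x * M * (diagonal x)⁻¹) i j = x i * M i j / x j := by
  have hinv : (diagonal x)⁻¹ = diagonal fun j => (x j)⁻¹ := by
    refine inv_eq_right_inv ?_
    rw [diagonal_mul_diagonal, ← diagonal_one]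
    exact congrArg _ (funext fun j => mul_inv_cancel₀ (hx j).ne')
  rw [hinv, mul_diagonal, diagonal_mul, div_eq_mul_inv]

theorem gram_diagonal_conj_apply_self {n : ℕ} {x : Fin n → ℝ} (hx : ∀ j, 0 < x j)
    (M : Matrix (Fin n) (Fin n) ℝ) (j : Fin n) :
    ((diagonal x * M * (diagonal x)⁻¹)ᵀ * (diagonal x * M * (diagonal x)⁻¹)) j j =
      ∑ i, M i j ^ 2 * (x i ^ 2 / x j ^ 2) := by
  rw [Matrix.mul_apply]
  refine Finset.sum_congr rfl fun i _ => ?_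
  rw [transpose_apply, diagonal_conj_apply hx]
  have := (hx j).ne'
  field_simp

theorem sum_gram_diagonal_conj_mul_sq {n : ℕ} {x : Fin n → ℝ} (hx : ∀ j, 0 < x j)
    {M : Matrix (Fin n) (Fin n) ℝ} (hM : Mᵀ * M = 1) :
    ∑ j, ((diagonal x * M * (diagonal x)⁻¹)ᵀ * (diagonal x * M * (diagonal x)⁻¹)) j j * x j ^ 2 =
      ∑ j, x j ^ 2 := by
  have e : ∀ i j, M i j ^ 2 * (x i ^ 2 / x j ^ 2) * x j ^ 2 = M i j ^ 2 * x i ^ 2 := fun i j => by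
    have := (hx j).ne'
    field_simp
  simp only [gram_diagonal_conj_apply_self hx, Finset.sum_mul, e]
  rw [Finset.sum_comm]
  simp only [← Finset.sum_mul, sum_sq_row_eq_one hM, one_mul]

/-- The trace condition linking the two Gram matrices, in terms of the orthogonal matrix `M`. -/
theorem sum_sq_mul_eq_of_gram_eq {n : ℕ} {x y : Fin n → ℝ} (hx : ∀ j, 0 < x j)
    (hy : ∀ j, 0 < y j) {M N : Matrix (Fin n) (Fin n) ℝ} (hN : Nᵀ * N = 1)
    (heq : (diagonal x * M * (diagonal x)⁻¹)ᵀ * (diagonal x * M * (diagonal x)⁻¹) =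
      (diagonal y * N * (diagonal y)⁻¹)ᵀ * (diagonal y * N * (diagonal y)⁻¹)) :
    ∑ j, ∑ i, M i j ^ 2 * (x i ^ 2 * (y j ^ 2 / x j ^ 2)) =
      ∑ j, x j ^ 2 * (y j ^ 2 / x j ^ 2) := by
  have h := sum_gram_diagonal_conj_mul_sq hy hN
  simp only [← heq, gram_diagonal_conj_apply_self hx, Finset.sum_mul] at h
  convert h using 2 with j _ j
  · refine Finset.sum_congr rfl fun i _ => by ring
  · have := (hx j).ne'
    field_simp

theorem diagonal_conj_eq_sign_of_offDiag_eq_zero {n : ℕ} {x : Fin n → ℝ} (hx : ∀ j, 0 < x j)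
    {M : Matrix (Fin n) (Fin n) ℝ} (hM : Mᵀ * M = 1) (h : ∀ i j, i ≠ j → M i j ^ 2 = 0) :
    (∀ j k, j ≠ k → (diagonal x * M * (diagonal x)⁻¹) j k = 0) ∧
      ∀ j, (diagonal x * M * (diagonal x)⁻¹) j j = 1 ∨
        (diagonal x * M * (diagonal x)⁻¹) j j = -1 := by
  refine ⟨fun j k hjk => ?_, fun j => ?_⟩
  · rw [diagonal_conj_apply hx, pow_eq_zero_iff two_ne_zero |>.1 (h j k hjk)]
    simp
  · rw [diagonal_conj_apply hx, mul_div_cancel_left₀ _ (hx j).ne']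
    have hj := sum_sq_col_eq_one hM j
    rw [Finset.sum_eq_single j (fun i _ hi => h i j hi) (by simp)] at hj
    exact sq_eq_one_iff.1 hj

theorem stmt_15 (n : ℕ) (hn : 1 ≤ n) (x y : Fin n → ℝ)
    (hx : StrictAnti x) (hxpos : ∀ j, 0 < x j)
    (hy : StrictMono y) (hypos : ∀ j, 0 < y j)
    (M₁ M₂ h₁ h₂ : Matrix (Fin n) (Fin n) ℝ)
    (hM₁ : M₁ᵀ * M₁ = 1) (hM₂ : M₂ᵀ * M₂ = 1)
    (hh₁ : h₁ = Matrix.diagonal x * M₁ * (Matrix.diagonal x)⁻¹)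
    (hh₂ : h₂ = Matrix.diagonal y * M₂ * (Matrix.diagonal y)⁻¹)
    (heq : h₁ᵀ * h₁ = h₂ᵀ * h₂) :
    ((∀ j k : Fin n, j ≠ k → h₁ j k = 0) ∧ (∀ j : Fin n, h₁ j j = 1 ∨ h₁ j j = -1)) ∧
    ((∀ j k : Fin n, j ≠ k → h₂ j k = 0) ∧ (∀ j : Fin n, h₂ j j = 1 ∨ h₂ j j = -1)) := by
  subst hh₁ hh₂
  have hratio : StrictMono fun j => y j ^ 2 / x j ^ 2 := fun i j hij =>
    div_lt_div₀ (pow_lt_pow_left₀ (hy hij) (hypos i).le two_ne_zero)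
      (pow_le_pow_left₀ (hxpos j).le (hx hij).le 2) (pow_pos (hypos j) 2).le (pow_pos (hxpos j) 2)
  have hratio' : StrictMono fun j => -(x j ^ 2 / y j ^ 2) := fun i j hij => neg_lt_neg <|
    div_lt_div₀ (pow_lt_pow_left₀ (hx hij) (hxpos j).le two_ne_zero)
      (pow_le_pow_left₀ (hypos i).le (hy hij).le 2) (pow_pos (hxpos i) 2).le (pow_pos (hypos i) 2)
  refine ⟨diagonal_conj_eq_sign_of_offDiag_eq_zero hxpos hM₁ fun i j hij => ?_,
    diagonal_conj_eq_sign_of_offDiag_eq_zero hypos hM₂ fun i j hij => ?_⟩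
  · exact eq_zero_of_sum_mul_eq (fun j => x j ^ 2) (fun j => y j ^ 2 / x j ^ 2)
      (fun i j h => pow_lt_pow_left₀ (hx h) (hxpos j).le two_ne_zero) hratio
      (fun i j => M₁ i j ^ 2) (fun i j => sq_nonneg _) (sum_sq_row_eq_one hM₁)
      (sum_sq_col_eq_one hM₁) (sum_sq_mul_eq_of_gram_eq hxpos hypos hM₂ heq) hij
  · exact eq_zero_of_sum_mul_eq (fun j => -y j ^ 2) (fun j => -(x j ^ 2 / y j ^ 2))
      (fun i j h => neg_lt_neg (pow_lt_pow_left₀ (hy h) (hypos i).le two_ne_zero)) hratio'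
      (fun i j => M₂ i j ^ 2) (fun i j => sq_nonneg _) (sum_sq_row_eq_one hM₂)
      (sum_sq_col_eq_one hM₂)
      (by simpa only [neg_mul_neg] using sum_sq_mul_eq_of_gram_eq hypos hxpos hM₁ heq.symm) hij
end

section
/- Let k be an algebraically closed field, let G be a linear algebraic group over k (a Zariski-closed subgroup of GL(n, k) for some n), and let V₁, V₂, V₃ be Zariski-closed subvarieties of G that satisfy the triple product property. Then dim V₁ + dim V₂ + dim V₃ ≤ dim G, where dim denotes the (topological Krull) dimension as an algebraic variety. -/
/-- The zero locus in the affine space of `n × n` matrices of an ideal of polynomials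
in the matrix entries. -/
def matrixZeroLocus (n : ℕ) (k : Type*) [CommRing k]
    (I : Ideal (MvPolynomial (Fin n × Fin n) k)) : Set (Matrix (Fin n) (Fin n) k) :=
  {M | ∀ p ∈ I, MvPolynomial.eval (fun q : Fin n × Fin n => M q.1 q.2) p = 0}

/-- The Zariski topology on the affine space of `n × n` matrices: the closed sets
are the zero loci of ideals of polynomials in the matrix entries. -/
def matrixZariskiTopology (n : ℕ) (k : Type*) [CommRing k] :
    TopologicalSpace (Matrix (Fin n) (Fin n) k) :=
  TopologicalSpace.generateFrom
    {U | ∃ I : Ideal (MvPolynomial (Fin n × Fin n) k), U = (matrixZeroLocus n k I)ᶜ}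

/-- A subset of matrix space is Zariski closed if it is closed in the Zariski topology. -/
def IsZariskiClosed {n : ℕ} {k : Type*} [CommRing k]
    (C : Set (Matrix (Fin n) (Fin n) k)) : Prop :=
  @IsClosed _ (matrixZariskiTopology n k) C

/-- The (topological Krull) dimension of a subset of matrix space, with respect to the
subspace topology induced by the Zariski topology: the supremum of lengths of chains of
irreducible closed subsets. -/
noncomputable def zariskiDim {n : ℕ} {k : Type*} [CommRing k]
    (V : Set (Matrix (Fin n) (Fin n) k)) : WithBot ℕ∞ :=
  @topologicalKrullDim V (TopologicalSpace.induced Subtype.val (matrixZariskiTopology n k))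

/-- The set of matrices underlying a set of elements of `GL(n, k)`. -/
def glImage {n : ℕ} {k : Type*} [CommRing k] (X : Set (GL (Fin n) k)) :
    Set (Matrix (Fin n) (Fin n) k) :=
  (fun g : GL (Fin n) k => (g : Matrix (Fin n) (Fin n) k)) '' X

open TensorProduct

universe u

theorem Ideal.height_le_height_comap_of_surjective {R S : Type*} [CommRing R] [CommRing S]
    {f : R →+* S} (hf : Function.Surjective f) (q : Ideal S) [q.IsPrime] :
    q.height ≤ (q.comap f).height := by
  have h := Order.height_le_height_apply_of_strictMono _
    (RingHom.strictMono_comap_of_surjective hf) ⟨q, ‹_›⟩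
  rwa [← PrimeSpectrum.height_eq_orderHeight, ← PrimeSpectrum.height_eq_orderHeight] at h

theorem ringKrullDim_quotient_le_of_le_radical {R : Type*} [CommRing R] {I J : Ideal R}
    (h : I ≤ J.radical) : ringKrullDim (R ⧸ J) ≤ ringKrullDim (R ⧸ I) := by
  rw [ringKrullDim_quotient, ringKrullDim_quotient]
  have hsub : PrimeSpectrum.zeroLocus (J : Set R) ⊆ PrimeSpectrum.zeroLocus (I : Set R) := by
    rw [← PrimeSpectrum.zeroLocus_radical J]
    exact PrimeSpectrum.zeroLocus_anti_mono h
  exact Order.krullDim_le_of_strictMono (Set.inclusion hsub) fun _ _ hab ↦ hab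

section FiniteType

variable {k : Type*} [Field k]

theorem ringKrullDim_lt_top_of_finiteType (A : Type*) [CommRing A] [Algebra k A]
    [Algebra.FiniteType k A] : ringKrullDim A < ⊤ := by
  obtain ⟨n, f, hf⟩ := Algebra.FiniteType.iff_quotient_mvPolynomial''.mp
    (inferInstance : Algebra.FiniteType k A)
  refine (ringKrullDim_le_of_surjective f.toRingHom hf).trans_lt ?_
  rw [MvPolynomial.ringKrullDim_of_isNoetherianRing, ringKrullDim_eq_zero_of_field, zero_add]
  exact WithBot.coe_lt_coe.mpr (ENat.natCast_lt_top _)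

theorem finiteRingKrullDim_of_finiteType (k : Type*) [Field k] (A : Type*) [CommRing A]
    [Algebra k A] [Algebra.FiniteType k A] [Nontrivial A] : FiniteRingKrullDim A :=
  finiteRingKrullDim_iff_ne_bot_and_top.mpr
    ⟨(ringKrullDim_nonneg_of_nontrivial.trans_lt' (WithBot.bot_lt_coe _)).ne',
      (ringKrullDim_lt_top_of_finiteType (k := k) A).ne⟩

/-- Weak Nullstellensatz -/
theorem Ideal.IsMaximal.exists_algHom_ker_eq [IsAlgClosed k] {A : Type*} [CommRing A] [Algebra k A]
    [Algebra.FiniteType k A] {M : Ideal A} (hM : M.IsMaximal) :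
    ∃ x : A →ₐ[k] k, RingHom.ker x = M := by
  let : Field (A ⧸ M) := Ideal.Quotient.field M
  have : Module.Finite k (A ⧸ M) := finite_of_finite_type_of_isJacobsonRing k (A ⧸ M)
  let φ : (A ⧸ M) →ₐ[k] k := IsAlgClosed.lift
  refine ⟨φ.comp (Ideal.Quotient.mkₐ k M), ?_⟩
  ext a
  simp [RingHom.mem_ker, Ideal.Quotient.eq_zero_iff_mem]

theorem mem_radical_of_forall_algHom [IsAlgClosed k] {A : Type*} [CommRing A] [Algebra k A]
    [Algebra.FiniteType k A] {J : Ideal A} {a : A}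
    (h : ∀ x : A →ₐ[k] k, J ≤ RingHom.ker x → x a = 0) : a ∈ J.radical := by
  have := isJacobsonRing_of_finiteType (A := k) (B := A)
  rw [J.radical_eq_jacobson]
  refine Ideal.mem_sInf.mpr fun {M} ⟨hJM, hM⟩ ↦ ?_
  obtain ⟨x, rfl⟩ := hM.exists_algHom_ker_eq (k := k)
  exact h x hJM

variable {A B : Type*} [CommRing A] [CommRing B] [Algebra k A] [Algebra k B]

theorem Algebra.FiniteType.tensorProduct [Algebra.FiniteType k A] [Algebra.FiniteType k B] :
    Algebra.FiniteType k (A ⊗[k] B) :=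
  .trans (S := A) inferInstance inferInstance

theorem height_add_height_le_height_ker_lift [Algebra.FiniteType k A] [Algebra.FiniteType k B]
    (x : A →ₐ[k] k) (y : B →ₐ[k] k) :
    (RingHom.ker x).height + (RingHom.ker y).height ≤
      (RingHom.ker (Algebra.TensorProduct.lift x y fun _ _ ↦ .all _ _)).height := by
  set z := Algebra.TensorProduct.lift x y fun _ _ ↦ .all _ _
  have : Algebra.FiniteType k (A ⊗[k] B) := .tensorProduct
  have : IsNoetherianRing A := Algebra.FiniteType.isNoetherianRing k _
  have : IsNoetherianRing (A ⊗[k] B) := Algebra.FiniteType.isNoetherianRing k _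
  have := RingHom.ker_isPrime x
  have := RingHom.ker_isPrime y
  have := RingHom.ker_isPrime z
  have hover : (RingHom.ker z).LiesOver (RingHom.ker x) := ⟨by
    ext a
    simp [Ideal.mem_comap, RingHom.mem_ker, Algebra.TensorProduct.algebraMap_apply, z]⟩
  rw [Ideal.height_eq_height_add_of_liesOver_of_hasGoingDown (RingHom.ker x) (RingHom.ker z)]
  gcongr
  let π : A ⊗[k] B →ₐ[k] B := Algebra.TensorProduct.lift ((Algebra.ofId k B).comp x) (.id k B)
    fun _ _ ↦ .all _ _
  have hπ : Function.Surjective π := fun b ↦ ⟨1 ⊗ₜ b, by simp [π]⟩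
  have hyπ : y.comp π = z := by ext <;> simp [π, z]
  let I := (RingHom.ker x).map (algebraMap A (A ⊗[k] B))
  have hI : ∀ a ∈ I, π a = 0 := by
    change I ≤ RingHom.ker π
    rw [Ideal.map_le_iff_le_comap]
    intro a ha
    simp [Ideal.mem_comap, RingHom.mem_ker, π, Algebra.TensorProduct.algebraMap_apply,
      (RingHom.mem_ker).mp ha]
  let π' : (A ⊗[k] B) ⧸ I →+* B := Ideal.Quotient.lift I π.toRingHom hI
  have hπ' : Function.Surjective π' := Ideal.Quotient.lift_surjective_of_surjective _ _ hπ
  refine (Ideal.height_le_height_comap_of_surjective hπ' _).trans (Ideal.height_mono ?_)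
  intro q hq
  obtain ⟨t, rfl⟩ := Ideal.Quotient.mk_surjective q
  refine Ideal.mem_map_of_mem _ ?_
  rw [← hyπ]
  exact hq

theorem ringKrullDim_add_le_ringKrullDim_tensorProduct [IsAlgClosed k] [Algebra.FiniteType k A]
    [Algebra.FiniteType k B] :
    ringKrullDim A + ringKrullDim B ≤ ringKrullDim (A ⊗[k] B) := by
  nontriviality A
  nontriviality B
  have := finiteRingKrullDim_of_finiteType k A
  have := finiteRingKrullDim_of_finiteType k B
  obtain ⟨p, hp, hpA⟩ := Ideal.exists_isMaximal_height (R := A)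
  obtain ⟨q, hq, hqB⟩ := Ideal.exists_isMaximal_height (R := B)
  obtain ⟨x, rfl⟩ := hp.exists_algHom_ker_eq (k := k)
  obtain ⟨y, rfl⟩ := hq.exists_algHom_ker_eq (k := k)
  have := RingHom.ker_isPrime (Algebra.TensorProduct.lift x y fun _ _ ↦ .all _ _)
  rw [← hpA, ← hqB, ← WithBot.coe_add]
  exact (WithBot.coe_le_coe.mpr (height_add_height_le_height_ker_lift x y)).trans
    Ideal.height_le_ringKrullDim_of_isPrime

/-- A product of three affine varieties has at least the expected dimension. -/
theorem exists_ringKrullDim_add_le_of_three {k : Type u} [Field k] [IsAlgClosed k]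
    (A₁ A₂ A₃ : Type u) [CommRing A₁] [CommRing A₂] [CommRing A₃]
    [Algebra k A₁] [Algebra k A₂] [Algebra k A₃]
    [Algebra.FiniteType k A₁] [Algebra.FiniteType k A₂] [Algebra.FiniteType k A₃] :
    ∃ (A : Type u) (_ : CommRing A) (_ : Algebra k A) (j₁ : A₁ →ₐ[k] A) (j₂ : A₂ →ₐ[k] A)
      (j₃ : A₃ →ₐ[k] A), Algebra.FiniteType k A ∧
      (∀ x y : A →ₐ[k] k, x.comp j₁ = y.comp j₁ → x.comp j₂ = y.comp j₂ →
        x.comp j₃ = y.comp j₃ → x = y) ∧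
      ringKrullDim A₁ + ringKrullDim A₂ + ringKrullDim A₃ ≤ ringKrullDim A := by
  have : Algebra.FiniteType k (A₁ ⊗[k] A₂) := .tensorProduct
  refine ⟨(A₁ ⊗[k] A₂) ⊗[k] A₃, inferInstance, inferInstance,
    Algebra.TensorProduct.includeLeft.comp Algebra.TensorProduct.includeLeft,
    Algebra.TensorProduct.includeLeft.comp Algebra.TensorProduct.includeRight,
    Algebra.TensorProduct.includeRight, .tensorProduct,
    fun x y e₁ e₂ e₃ ↦ Algebra.TensorProduct.ext (Algebra.TensorProduct.ext e₁ e₂) e₃, ?_⟩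
  exact (add_le_add_left (ringKrullDim_add_le_ringKrullDim_tensorProduct (k := k)) _).trans
    (ringKrullDim_add_le_ringKrullDim_tensorProduct (k := k))

/-- If a morphism from `X × X` has the diagonal as a fibre over a rational point, then the
dimension of the target is at least the dimension of `X`. -/
theorem ringKrullDim_le_of_fiber_eq_diagonal [IsAlgClosed k] [Algebra.FiniteType k A]
    [Algebra.FiniteType k B] (φ : B →ₐ[k] A ⊗[k] A) (e : B →ₐ[k] k)
    (hdiag : ∀ x : A →ₐ[k] k,
      (Algebra.TensorProduct.lift x x fun _ _ ↦ .all _ _).comp φ = e)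
    (hfib : ∀ x y : A →ₐ[k] k,
      (Algebra.TensorProduct.lift x y fun _ _ ↦ .all _ _).comp φ = e → x = y) :
    ringKrullDim A ≤ ringKrullDim B := by
  nontriviality A
  have := finiteRingKrullDim_of_finiteType k A
  obtain ⟨p, hp, hpA⟩ := Ideal.exists_isMaximal_height (R := A)
  obtain ⟨x, rfl⟩ := hp.exists_algHom_ker_eq (k := k)
  have : Algebra.FiniteType k (A ⊗[k] A) := .tensorProduct
  have : IsNoetherianRing B := Algebra.FiniteType.isNoetherianRing k _
  have : IsNoetherianRing (A ⊗[k] A) := Algebra.FiniteType.isNoetherianRing k _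
  set z := Algebra.TensorProduct.lift x x fun _ _ ↦ .all _ _ with hz
  have := RingHom.ker_isPrime z
  have := RingHom.ker_isPrime e
  let := φ.toRingHom.toAlgebra
  have hover : (RingHom.ker z).LiesOver (RingHom.ker e) := ⟨by
    rw [← hdiag x]; rfl⟩
  have h1 := height_add_height_le_height_ker_lift x x
  have h2 := Ideal.height_le_height_add_of_liesOver (RingHom.ker e) (RingHom.ker z)
  let J := (RingHom.ker e).map (algebraMap B (A ⊗[k] A))
  let μ : A ⊗[k] A →ₐ[k] A := Algebra.TensorProduct.lmul' k
  have hμ : RingHom.ker μ ≤ J.radical := by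
    intro t ht
    refine mem_radical_of_forall_algHom (k := k) fun w hw ↦ ?_
    let x' := w.comp Algebra.TensorProduct.includeLeft
    let y' := w.comp Algebra.TensorProduct.includeRight
    have hw' : w = Algebra.TensorProduct.lift x' y' fun _ _ ↦ .all _ _ := by
      ext <;> simp [x', y']
    have hwe : w.comp φ = e := by
      ext b
      have : b - algebraMap k B (e b) ∈ RingHom.ker e := by simp [RingHom.mem_ker]
      have := hw (Ideal.mem_map_of_mem _ this)
      rw [RingHom.mem_ker, map_sub, map_sub, sub_eq_zero] at this
      change w (φ b) = w (φ _) at this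
      simpa only [AlgHom.commutes, Algebra.algebraMap_self_apply, AlgHom.comp_apply] using this
    have hxy : x' = y' := hfib _ _ (hw' ▸ hwe)
    have : w = x'.comp μ := by
      ext a
      · simp [x', μ]
      · rw [hxy]; simp [y', μ]
    rw [this, AlgHom.comp_apply, (RingHom.mem_ker).mp ht, map_zero]
  have hJ : J ≤ RingHom.ker z := by
    rw [Ideal.map_le_iff_le_comap, ← Ideal.under_def, ← Ideal.LiesOver.over (p := RingHom.ker e)]
  have hne : (RingHom.ker z).map (Ideal.Quotient.mk J) ≠ ⊤ := by
    rw [Ideal.ne_top_iff_one, ← map_one (Ideal.Quotient.mk J), Ideal.mem_quotient_iff_mem hJ]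
    simp [RingHom.mem_ker]
  have hfibre : (((RingHom.ker z).map (Ideal.Quotient.mk J)).height : WithBot ℕ∞) ≤
      (RingHom.ker x).height := by
    refine (Ideal.height_le_ringKrullDim_of_ne_top hne).trans ?_
    rw [hpA]
    refine (ringKrullDim_quotient_le_of_le_radical hμ).trans_eq ?_
    have hμs : Function.Surjective μ.toRingHom := fun a ↦ ⟨a ⊗ₜ 1, by simp [μ]⟩
    exact ringKrullDim_eq_of_ringEquiv (RingHom.quotientKerEquivOfSurjective hμs)
  have h3 := (h1.trans h2).trans (add_le_add_right (WithBot.coe_le_coe.mp hfibre) _)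
  have h4 : (RingHom.ker x).height ≠ ⊤ := Ideal.height_ne_top hp.ne_top
  rw [← hpA]
  exact (WithBot.coe_le_coe.mpr ((ENat.add_le_add_iff_right h4).mp h3)).trans
    Ideal.height_le_ringKrullDim_of_isPrime

theorem ringKrullDim_le_quotient_of_fiber_eq_diagonal [IsAlgClosed k] [Algebra.FiniteType k A]
    [Algebra.FiniteType k B] (φ : B →ₐ[k] A ⊗[k] A) (e : B →ₐ[k] k)
    (hdiag : ∀ x : A →ₐ[k] k,
      (Algebra.TensorProduct.lift x x fun _ _ ↦ .all _ _).comp φ = e)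
    (hfib : ∀ x y : A →ₐ[k] k,
      (Algebra.TensorProduct.lift x y fun _ _ ↦ .all _ _).comp φ = e → x = y)
    {I : Ideal B} (hI : ∀ x y : A →ₐ[k] k,
      I ≤ RingHom.ker ((Algebra.TensorProduct.lift x y fun _ _ ↦ .all _ _).comp φ)) :
    ringKrullDim A ≤ ringKrullDim (B ⧸ I) := by
  nontriviality A
  obtain ⟨p, hp⟩ := Ideal.exists_maximal A
  obtain ⟨x₀, -⟩ := hp.exists_algHom_ker_eq (k := k)
  have : Algebra.FiniteType k (A ⊗[k] A) := .tensorProduct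
  have he : ∀ b ∈ RingHom.ker φ, e b = 0 := fun b hb ↦ by
    rw [← hdiag x₀, AlgHom.comp_apply, (RingHom.mem_ker).mp hb, map_zero]
  have hcomp (x y : A →ₐ[k] k) : ((Algebra.TensorProduct.lift x y fun _ _ ↦ .all _ _).comp
      (Ideal.kerLiftAlg φ)).comp (Ideal.Quotient.mkₐ k _) =
      (Algebra.TensorProduct.lift x y fun _ _ ↦ .all _ _).comp φ := by
    ext; rfl
  refine (ringKrullDim_le_of_fiber_eq_diagonal (Ideal.kerLiftAlg φ)
    (Ideal.Quotient.liftₐ _ e he) (fun x ↦ ?_) fun x y hxy ↦ hfib x y ?_).trans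
    (ringKrullDim_quotient_le_of_le_radical fun f hf ↦ ?_)
  · refine Ideal.Quotient.algHom_ext _ ?_
    rw [hcomp, hdiag]
    rfl
  · rw [← hcomp, hxy]
    rfl
  · have hnil : φ f ∈ (⊥ : Ideal (A ⊗[k] A)).radical := by
      refine mem_radical_of_forall_algHom (k := k) fun w _ ↦ ?_
      have hw : w = Algebra.TensorProduct.lift (w.comp Algebra.TensorProduct.includeLeft)
          (w.comp Algebra.TensorProduct.includeRight) fun _ _ ↦ .all _ _ := by
        ext <;> simp
      rw [hw]
      exact hI _ _ hf
    obtain ⟨m, hm⟩ := hnil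
    exact ⟨m, by rwa [RingHom.mem_ker, map_pow]⟩
end FiniteType

theorem Topology.IsInducing.isPreirreducible_of_image {X Y : Type*} [TopologicalSpace X]
    [TopologicalSpace Y] {f : Y → X} (hf : IsInducing f) {s : Set Y}
    (hs : IsPreirreducible (f '' s)) : IsPreirreducible s := by
  intro u v hu hv ⟨y, hys, hyu⟩ ⟨y', hys', hyv⟩
  obtain ⟨u', hu', rfl⟩ := hf.isOpen_iff.mp hu
  obtain ⟨v', hv', rfl⟩ := hf.isOpen_iff.mp hv
  obtain ⟨_, ⟨w, hw, rfl⟩, hwuv⟩ :=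
    hs u' v' hu' hv' ⟨f y, ⟨y, hys, rfl⟩, hyu⟩ ⟨f y', ⟨y', hys', rfl⟩, hyv⟩
  exact ⟨w, hw, hwuv⟩

open TopologicalSpace in
theorem Topology.IsInducing.topologicalKrullDim_eq_of_closedPoints_subset_range {X Y : Type*}
    [TopologicalSpace X] [TopologicalSpace Y] [JacobsonSpace X] {f : Y → X} (hf : IsInducing f)
    (h : closedPoints X ⊆ Set.range f) : topologicalKrullDim Y = topologicalKrullDim X := by
  refine hf.topologicalKrullDim_le.antisymm ?_
  have hclosure : ∀ Z : IrreducibleCloseds X, closure (f '' (f ⁻¹' Z)) = Z := by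
    intro Z
    refine (Z.isClosed'.closure_subset_iff.mpr (Set.image_preimage_subset f Z)).antisymm ?_
    refine (JacobsonSpace.closure_inter_closedPoints Z.isClosed').symm.subset.trans
      (closure_mono ?_)
    rw [Set.image_preimage_eq_inter_range]
    exact Set.inter_subset_inter_right _ h
  let F (Z : IrreducibleCloseds X) : IrreducibleCloseds Y :=
    { carrier := f ⁻¹' Z
      isIrreducible' := by
        have := Z.isIrreducible'
        change IsIrreducible (Z : Set X) at this
        rw [← hclosure Z, isIrreducible_iff_closure] at this
        exact ⟨this.nonempty.of_image, hf.isPreirreducible_of_image this.isPreirreducible⟩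
      isClosed' := Z.isClosed'.preimage hf.continuous }
  have hF : Monotone F := fun Z Z' hZ ↦ Set.preimage_mono (f := f) hZ
  refine Order.krullDim_le_of_strictMono F (hF.strictMono_of_injective fun Z Z' hZ ↦ ?_)
  have : f ⁻¹' Z = f ⁻¹' Z' := congrArg IrreducibleCloseds.carrier hZ
  exact SetLike.coe_injective (by rw [← hclosure Z, ← hclosure Z', this])

section MatrixPoints

open MvPolynomial

variable {n : ℕ} {k : Type*} [Field k]

theorem isZariskiClosed_iff_exists_ideal {C : Set (Matrix (Fin n) (Fin n) k)} :
    IsZariskiClosed C ↔ ∃ I, C = matrixZeroLocus n k I := by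
  constructor
  · intro h
    have h := (@isOpen_compl_iff _ _ (matrixZariskiTopology n k)).mpr h
    suffices ∀ U, TopologicalSpace.GenerateOpen
        {U | ∃ I : Ideal (MvPolynomial (Fin n × Fin n) k), U = (matrixZeroLocus n k I)ᶜ} U →
        ∃ I, Uᶜ = matrixZeroLocus n k I by
      simpa using this _ h
    intro U hU
    induction hU with
    | basic U hU =>
      obtain ⟨I, rfl⟩ := hU
      exact ⟨I, compl_compl _⟩
    | univ => exact ⟨⊤, by ext M; simpa [matrixZeroLocus] using ⟨1, by simp⟩⟩
    | inter U V _ _ hU hV =>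
      obtain ⟨I, hI⟩ := hU
      obtain ⟨J, hJ⟩ := hV
      refine ⟨I ⊓ J, ?_⟩
      rw [Set.compl_inter, hI, hJ]
      ext M
      constructor
      · rintro (h | h) p ⟨hp, hp'⟩
        exacts [h p hp, h p hp']
      · intro h
        by_contra! hcon
        simp only [matrixZeroLocus, Set.mem_union, Set.mem_ofPred_eq, not_or, not_forall] at hcon
        obtain ⟨⟨p, hp, hp0⟩, q, hq, hq0⟩ := hcon
        have := h (p * q) ⟨I.mul_mem_right _ hp, J.mul_mem_left _ hq⟩
        rw [map_mul] at this
        exact mul_ne_zero hp0 hq0 this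
    | sUnion S _ hS =>
      choose! I hI using hS
      refine ⟨⨆ U ∈ S, I U, ?_⟩
      ext M
      rw [Set.compl_sUnion]
      let E := RingHom.ker (eval fun q : Fin n × Fin n ↦ M q.1 q.2)
      have hE : ∀ J, M ∈ matrixZeroLocus n k J ↔ J ≤ E := fun J ↦ Iff.rfl
      rw [hE]
      simp only [Set.sInter_image, Set.mem_iInter, iSup_le_iff]
      exact forall₂_congr fun U hU ↦ by rw [← hE, ← hI U hU]
  · rintro ⟨I, rfl⟩
    exact @IsClosed.mk _ (matrixZariskiTopology n k) _ (.basic _ ⟨I, rfl⟩)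

/-- The entries of a matrix together with those of its inverse. -/
noncomputable def matrixCoords (M : Matrix (Fin n) (Fin n) k) :
    (Fin n × Fin n) ⊕ (Fin n × Fin n) → k :=
  Sum.elim (fun q ↦ M q.1 q.2) fun q ↦ M⁻¹ q.1 q.2

variable (n k) in
/-- Polynomials in the entries of a matrix and those of its inverse. -/
abbrev MatrixPolynomial : Type _ := MvPolynomial ((Fin n × Fin n) ⊕ (Fin n × Fin n)) k

/-- Evaluation at a matrix. -/
noncomputable def matrixEval (M : Matrix (Fin n) (Fin n) k) : MatrixPolynomial n k →ₐ[k] k :=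
  aeval (matrixCoords M)

/-- The ideal of polynomials vanishing on a set of matrices. -/
noncomputable def matrixIdeal (W : Set (Matrix (Fin n) (Fin n) k)) : Ideal (MatrixPolynomial n k) :=
  ⨅ M ∈ W, RingHom.ker (matrixEval M)

theorem mem_matrixIdeal {W : Set (Matrix (Fin n) (Fin n) k)} {f : MatrixPolynomial n k} :
    f ∈ matrixIdeal W ↔ ∀ M ∈ W, matrixEval M f = 0 := by
  simp [matrixIdeal, RingHom.mem_ker]

/-- Clearing denominators: a polynomial in the entries of an invertible matrix and of its inverse
is a polynomial in the entries, up to a power of the determinant. -/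
theorem exists_eval_eq_det_pow_mul_matrixEval (f : MatrixPolynomial n k) :
    ∃ (N : ℕ) (p : MvPolynomial (Fin n × Fin n) k), ∀ M : Matrix (Fin n) (Fin n) k, IsUnit M →
      eval (fun q : Fin n × Fin n ↦ M q.1 q.2) p = M.det ^ N * matrixEval M f := by
  let D : MvPolynomial (Fin n × Fin n) k := (Matrix.mvPolynomialX (Fin n) (Fin n) k).det
  have hX : ∀ M : Matrix (Fin n) (Fin n) k, (Matrix.mvPolynomialX (Fin n) (Fin n) k).map
      (eval fun q : Fin n × Fin n ↦ M q.1 q.2) = M := fun M ↦ by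
    ext i j; simp [Matrix.mvPolynomialX]
  have hD : ∀ M : Matrix (Fin n) (Fin n) k, eval (fun q : Fin n × Fin n ↦ M q.1 q.2) D = M.det :=
    fun M ↦ by rw [RingHom.map_det, RingHom.mapMatrix_apply, hX]
  induction f using MvPolynomial.induction_on with
  | C a => exact ⟨0, C a, fun M _ ↦ by simp [matrixEval]⟩
  | add f g hf hg =>
    obtain ⟨N, p, hp⟩ := hf
    obtain ⟨N', p', hp'⟩ := hg
    refine ⟨N + N', p * D ^ N' + p' * D ^ N, fun M hM ↦ ?_⟩
    simp only [map_add, map_mul, map_pow, hp M hM, hp' M hM, hD]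
    ring
  | mul_X f q hf =>
    obtain ⟨N, p, hp⟩ := hf
    rcases q with q | q
    · refine ⟨N, p * X q, fun M hM ↦ ?_⟩
      simp only [map_mul, hp M hM, eval_X, matrixEval, aeval_X, matrixCoords, Sum.elim_inl]
      ring
    · refine ⟨N + 1, p * (Matrix.mvPolynomialX (Fin n) (Fin n) k).adjugate q.1 q.2, fun M hM ↦ ?_⟩
      have hadj : eval (fun q : Fin n × Fin n ↦ M q.1 q.2)
          ((Matrix.mvPolynomialX (Fin n) (Fin n) k).adjugate q.1 q.2) = M.adjugate q.1 q.2 := by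
        have := RingHom.map_adjugate (eval fun q : Fin n × Fin n ↦ M q.1 q.2)
          (Matrix.mvPolynomialX (Fin n) (Fin n) k)
        simp only [RingHom.mapMatrix_apply, hX] at this
        rw [← this]
        rfl
      have hinv : M.adjugate q.1 q.2 = M.det * M⁻¹ q.1 q.2 := by
        have hdet := ((Matrix.isUnit_iff_isUnit_det M).mp hM).ne_zero
        rw [Matrix.inv_def, Ring.inverse_eq_inv', Matrix.smul_apply, smul_eq_mul,
          mul_inv_cancel_left₀ hdet]
      simp only [map_mul, hp M hM, hadj, hinv, matrixEval, aeval_X, matrixCoords, Sum.elim_inr]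
      ring

/-- The prime ideal of polynomials vanishing at a matrix. -/
noncomputable def matrixPoint (M : Matrix (Fin n) (Fin n) k) :
    PrimeSpectrum (MatrixPolynomial n k) :=
  ⟨RingHom.ker (matrixEval M), RingHom.ker_isPrime _⟩

theorem isInducing_matrixPoint {W : Set (Matrix (Fin n) (Fin n) k)} (hW : ∀ M ∈ W, IsUnit M) :
    letI : TopologicalSpace (Matrix (Fin n) (Fin n) k) := matrixZariskiTopology n k
    Topology.IsInducing fun M : W ↦ matrixPoint M.1 := by
  let : TopologicalSpace (Matrix (Fin n) (Fin n) k) := matrixZariskiTopology n k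
  refine ⟨TopologicalSpace.ext_isClosed fun S ↦ ?_⟩
  rw [isClosed_induced_iff, isClosed_induced_iff]
  constructor
  · rintro ⟨C, hC, rfl⟩
    obtain ⟨I, rfl⟩ := isZariskiClosed_iff_exists_ideal.mp hC
    refine ⟨PrimeSpectrum.zeroLocus (rename Sum.inl '' (I : Set _)),
      PrimeSpectrum.isClosed_zeroLocus _, ?_⟩
    ext M
    simp only [Set.mem_preimage, PrimeSpectrum.mem_zeroLocus, Set.image_subset_iff]
    refine forall₂_congr fun p _ ↦ ?_
    simp [matrixPoint, RingHom.mem_ker, matrixEval, aeval_rename, matrixCoords,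
      Function.comp_def, aeval_eq_eval]
  · rintro ⟨Z, hZ, rfl⟩
    obtain ⟨s, rfl⟩ := (PrimeSpectrum.isClosed_iff_zeroLocus _).mp hZ
    choose N p hp using exists_eval_eq_det_pow_mul_matrixEval (n := n) (k := k)
    refine ⟨matrixZeroLocus n k (Ideal.span (p '' s)),
      isZariskiClosed_iff_exists_ideal.mpr ⟨_, rfl⟩, ?_⟩
    ext M
    have hdet := ((Matrix.isUnit_iff_isUnit_det _).mp (hW M M.2)).ne_zero
    change Ideal.span (p '' s) ≤ RingHom.ker (eval fun q : Fin n × Fin n ↦ M.1 q.1 q.2) ↔ _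
    rw [Ideal.span_le, Set.image_subset_iff]
    refine forall₂_congr fun f _ ↦ ?_
    simp [RingHom.mem_ker, hp f M (hW M M.2), hdet, matrixPoint]

/-- Every point of the coordinate ring of a closed set of invertible matrices is the evaluation at
some matrix in the set. -/
theorem exists_eq_matrixEval_of_matrixIdeal_le {C : Set (Matrix (Fin n) (Fin n) k)}
    (hC : IsZariskiClosed C) {x : MatrixPolynomial n k →ₐ[k] k}
    (hx : matrixIdeal ({M | IsUnit M} ∩ C) ≤ RingHom.ker x) :
    ∃ M ∈ {M | IsUnit M} ∩ C, x = matrixEval M := by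
  let A : Matrix (Fin n) (Fin n) k := .of fun i j ↦ x (X (.inl (i, j)))
  let B : Matrix (Fin n) (Fin n) k := .of fun i j ↦ x (X (.inr (i, j)))
  have hAB : A * B = 1 := by
    ext i j
    have : (∑ l, X (.inl (i, l)) * X (.inr (l, j)) -
        MvPolynomial.C ((1 : Matrix (Fin n) (Fin n) k) i j) : MatrixPolynomial n k) ∈
        matrixIdeal ({M | IsUnit M} ∩ C) := by
      rw [mem_matrixIdeal]
      intro M hM
      have := congrFun₂ (M.mul_nonsing_inv ((Matrix.isUnit_iff_isUnit_det M).mp hM.1)) i j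
      rw [Matrix.mul_apply] at this
      simp [matrixEval, matrixCoords, this]
    have := hx this
    rw [RingHom.mem_ker, map_sub, sub_eq_zero, map_sum] at this
    simpa [Matrix.mul_apply, A, B, ← algebraMap_eq] using this
  have hA : IsUnit A :=
    (Matrix.isUnit_iff_isUnit_det A).mpr (Matrix.isUnit_det_of_right_inverse hAB)
  have hxA : x = matrixEval A := by
    ext q
    rcases q with q | q
    · simp [matrixEval, matrixCoords, A]
    · simp [matrixEval, matrixCoords, Matrix.inv_eq_right_inv hAB, B]
  refine ⟨A, ⟨hA, ?_⟩, hxA⟩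
  obtain ⟨I, rfl⟩ := isZariskiClosed_iff_exists_ideal.mp hC
  intro p hp
  have : rename Sum.inl p ∈ matrixIdeal ({M | IsUnit M} ∩ matrixZeroLocus n k I) := by
    rw [mem_matrixIdeal]
    intro M hM
    simpa [matrixEval, aeval_rename, matrixCoords, Function.comp_def, aeval_eq_eval]
      using hM.2 p hp
  have := hx this
  rw [hxA] at this
  simpa [matrixEval, aeval_rename, matrixCoords, Function.comp_def, aeval_eq_eval,
    RingHom.mem_ker] using this

theorem zariskiDim_eq_ringKrullDim [IsAlgClosed k] {C : Set (Matrix (Fin n) (Fin n) k)}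
    (hC : IsZariskiClosed C) :
    zariskiDim ({M | IsUnit M} ∩ C) =
      ringKrullDim (MatrixPolynomial n k ⧸ matrixIdeal ({M | IsUnit M} ∩ C)) := by
  set W := {M : Matrix (Fin n) (Fin n) k | IsUnit M} ∩ C with hW
  let : TopologicalSpace (Matrix (Fin n) (Fin n) k) := matrixZariskiTopology n k
  have hle (M : W) : matrixIdeal W ≤ RingHom.ker (matrixEval M.1) := iInf₂_le M.1 M.2
  let q (M : W) : PrimeSpectrum (MatrixPolynomial n k ⧸ matrixIdeal W) :=
    ⟨RingHom.ker (Ideal.Quotient.liftₐ (matrixIdeal W) (matrixEval M.1) (hle M)),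
      RingHom.ker_isPrime _⟩
  have hcomap : PrimeSpectrum.comap (Ideal.Quotient.mk (matrixIdeal W)) ∘ q =
      fun M : W ↦ matrixPoint M.1 := by
    ext M f
    exact Iff.rfl
  have hq : Topology.IsInducing q := by
    rw [← (PrimeSpectrum.isClosedEmbedding_comap_of_surjective _ _
      Ideal.Quotient.mk_surjective).isInducing.of_comp_iff, hcomap]
    exact isInducing_matrixPoint fun M hM ↦ hM.1
  have := isJacobsonRing_of_finiteType (A := k) (B := MatrixPolynomial n k ⧸ matrixIdeal W)
  have hrange : closedPoints (PrimeSpectrum (MatrixPolynomial n k ⧸ matrixIdeal W)) ⊆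
      Set.range q := by
    intro P hP
    obtain ⟨x, hx⟩ := ((PrimeSpectrum.isClosed_singleton_iff_isMaximal P).mp
      hP).exists_algHom_ker_eq (k := k)
    obtain ⟨M, hM, hMx⟩ := exists_eq_matrixEval_of_matrixIdeal_le hC
      (x := x.comp (Ideal.Quotient.mkₐ k _)) fun f hf ↦ by
        change x (Ideal.Quotient.mk _ f) = 0
        rw [Ideal.Quotient.eq_zero_iff_mem.mpr hf, map_zero]
    refine ⟨⟨M, hM⟩, PrimeSpectrum.ext ?_⟩
    rw [← hx]
    ext f
    obtain ⟨f, rfl⟩ := Ideal.Quotient.mk_surjective f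
    change matrixEval M f = 0 ↔ x (Ideal.Quotient.mk _ f) = 0
    rw [← hMx]
    rfl
  exact (hq.topologicalKrullDim_eq_of_closedPoints_subset_range hrange).trans
    (PrimeSpectrum.topologicalKrullDim_eq_ringKrullDim _)

theorem exists_comp_mk_eq_matrixEval {V : Set (GL (Fin n) k)}
    (hV : ∃ C, IsZariskiClosed C ∧ glImage V = {M | IsUnit M} ∩ C)
    (x : (MatrixPolynomial n k ⧸ matrixIdeal (glImage V)) →ₐ[k] k) :
    ∃ g ∈ V, x.comp (Ideal.Quotient.mkₐ k _) = matrixEval g.1 := by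
  obtain ⟨C, hC, hVC⟩ := hV
  obtain ⟨M, hM, hx⟩ := exists_eq_matrixEval_of_matrixIdeal_le hC
    (x := x.comp (Ideal.Quotient.mkₐ k _)) fun f hf ↦ by
      rw [← hVC] at hf
      change x (Ideal.Quotient.mk _ f) = 0
      rw [Ideal.Quotient.eq_zero_iff_mem.mpr hf, map_zero]
  rw [← hVC] at hM
  obtain ⟨g, hg, rfl⟩ := hM
  exact ⟨g, hg, hx⟩

theorem matrixEval_injective :
    Function.Injective (matrixEval : Matrix (Fin n) (Fin n) k → _) := fun M N h ↦ by
  ext i j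
  simpa [matrixEval, matrixCoords] using DFunLike.congr_fun h (X (.inl (i, j)))

section Convolution

variable {S : Type*} [CommRing S] [Algebra k S]

/-- The matrix with coordinates in an algebra `S` determined by a ring map. -/
noncomputable def coordMatrix (α : MatrixPolynomial n k →ₐ[k] S) : Matrix (Fin n) (Fin n) S :=
  .of fun i j ↦ α (X (.inl (i, j)))

/-- The inverse matrix with coordinates in an algebra `S` determined by a ring map. -/
noncomputable def coordInv (α : MatrixPolynomial n k →ₐ[k] S) : Matrix (Fin n) (Fin n) S :=
  .of fun i j ↦ α (X (.inr (i, j)))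

/-- The ring map with prescribed values of the coordinates of a matrix and of its inverse. -/
noncomputable def ofCoords (M N : Matrix (Fin n) (Fin n) S) : MatrixPolynomial n k →ₐ[k] S :=
  aeval (Sum.elim (fun q ↦ M q.1 q.2) fun q ↦ N q.1 q.2)

/-- The ring map corresponding to the product of two matrices. -/
noncomputable def mulHom (α β : MatrixPolynomial n k →ₐ[k] S) : MatrixPolynomial n k →ₐ[k] S :=
  ofCoords (coordMatrix α * coordMatrix β) (coordInv β * coordInv α)

/-- The ring map corresponding to the quotient of two matrices. -/
noncomputable def divHom (α β : MatrixPolynomial n k →ₐ[k] S) : MatrixPolynomial n k →ₐ[k] S :=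
  ofCoords (coordMatrix α * coordInv β) (coordMatrix β * coordInv α)

theorem comp_ofCoords {z : S →ₐ[k] k} {M N : Matrix (Fin n) (Fin n) S} {g : GL (Fin n) k}
    (hM : M.map z = g) (hN : N.map z = (g⁻¹ : GL (Fin n) k)) :
    z.comp (ofCoords M N) = matrixEval g.1 := by
  ext q
  rcases q with ⟨i, j⟩ | ⟨i, j⟩
  · simpa [ofCoords, matrixEval, matrixCoords] using congrFun₂ hM i j
  · rw [Matrix.coe_units_inv] at hN
    simpa [ofCoords, matrixEval, matrixCoords] using congrFun₂ hN i j

variable {α β : MatrixPolynomial n k →ₐ[k] S} {z : S →ₐ[k] k} {g h : GL (Fin n) k}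

theorem coordMatrix_map (hα : z.comp α = matrixEval g.1) : (coordMatrix α).map z = g := by
  ext i j
  simpa [coordMatrix, matrixEval, matrixCoords] using DFunLike.congr_fun hα (X (.inl (i, j)))

theorem coordInv_map (hα : z.comp α = matrixEval g.1) :
    (coordInv α).map z = (g⁻¹ : GL (Fin n) k) := by
  ext i j
  simpa [coordInv, matrixEval, matrixCoords] using DFunLike.congr_fun hα (X (.inr (i, j)))

theorem comp_mulHom (hα : z.comp α = matrixEval g.1) (hβ : z.comp β = matrixEval h.1) :
    z.comp (mulHom α β) = matrixEval (g * h).1 := by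
  refine comp_ofCoords ?_ ?_
  · rw [Matrix.map_mul, coordMatrix_map hα, coordMatrix_map hβ, Units.val_mul]
  · rw [Matrix.map_mul, coordInv_map hα, coordInv_map hβ, mul_inv_rev, Units.val_mul]

theorem comp_divHom (hα : z.comp α = matrixEval g.1) (hβ : z.comp β = matrixEval h.1) :
    z.comp (divHom α β) = matrixEval (g * h⁻¹).1 := by
  refine comp_ofCoords ?_ ?_
  · rw [Matrix.map_mul, coordMatrix_map hα, coordInv_map hβ, Units.val_mul]
  · rw [Matrix.map_mul, coordInv_map hα, coordMatrix_map hβ, mul_inv_rev, inv_inv, Units.val_mul]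

end Convolution

theorem IsZariskiClosed.glImage_of_inter {V W : Set (GL (Fin n) k)}
    (hW : ∃ C, IsZariskiClosed C ∧ glImage W = {M | IsUnit M} ∩ C)
    (hV : ∃ C, IsZariskiClosed C ∧ glImage V = glImage W ∩ C) :
    ∃ C, IsZariskiClosed C ∧ glImage V = {M | IsUnit M} ∩ C := by
  obtain ⟨C, hC, hWC⟩ := hW
  obtain ⟨D, hD, hVD⟩ := hV
  exact ⟨C ∩ D, @IsClosed.inter _ _ _ (matrixZariskiTopology n k) hC hD,
    by rw [hVD, hWC, Set.inter_assoc]⟩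

theorem zariskiDim_glImage_eq_ringKrullDim [IsAlgClosed k] {V : Set (GL (Fin n) k)}
    (hV : ∃ C, IsZariskiClosed C ∧ glImage V = {M | IsUnit M} ∩ C) :
    zariskiDim (glImage V) = ringKrullDim (MatrixPolynomial n k ⧸ matrixIdeal (glImage V)) := by
  obtain ⟨C, hC, hVC⟩ := hV
  rw [hVC, zariskiDim_eq_ringKrullDim hC]

theorem ringKrullDim_le_of_tripleProductProperty [IsAlgClosed k] {G : Subgroup (GL (Fin n) k)}
    {V₁ V₂ V₃ : Set (GL (Fin n) k)} (hV₁G : V₁ ⊆ G) (hV₂G : V₂ ⊆ G) (hV₃G : V₃ ⊆ G)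
    (hV₁ : ∃ C, IsZariskiClosed C ∧ glImage V₁ = {M | IsUnit M} ∩ C)
    (hV₂ : ∃ C, IsZariskiClosed C ∧ glImage V₂ = {M | IsUnit M} ∩ C)
    (hV₃ : ∃ C, IsZariskiClosed C ∧ glImage V₃ = {M | IsUnit M} ∩ C)
    (htpp : TripleProductProperty V₁ V₂ V₃) {A : Type*} [CommRing A] [Algebra k A]
    [Algebra.FiniteType k A]
    (j₁ : (MatrixPolynomial n k ⧸ matrixIdeal (glImage V₁)) →ₐ[k] A)
    (j₂ : (MatrixPolynomial n k ⧸ matrixIdeal (glImage V₂)) →ₐ[k] A)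
    (j₃ : (MatrixPolynomial n k ⧸ matrixIdeal (glImage V₃)) →ₐ[k] A)
    (hj : ∀ x y : A →ₐ[k] k, x.comp j₁ = y.comp j₁ → x.comp j₂ = y.comp j₂ →
      x.comp j₃ = y.comp j₃ → x = y) :
    ringKrullDim A ≤
      ringKrullDim (MatrixPolynomial n k ⧸ matrixIdeal (glImage (G : Set (GL (Fin n) k)))) := by
  let i₁ := j₁.comp (Ideal.Quotient.mkₐ k _)
  let i₂ := j₂.comp (Ideal.Quotient.mkₐ k _)
  let i₃ := j₃.comp (Ideal.Quotient.mkₐ k _)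
  choose g₁ hg₁ hx₁ using fun x : A →ₐ[k] k ↦
    exists_comp_mk_eq_matrixEval hV₁ (x.comp j₁)
  choose g₂ hg₂ hx₂ using fun x : A →ₐ[k] k ↦
    exists_comp_mk_eq_matrixEval hV₂ (x.comp j₂)
  choose g₃ hg₃ hx₃ using fun x : A →ₐ[k] k ↦
    exists_comp_mk_eq_matrixEval hV₃ (x.comp j₃)
  let l : A →ₐ[k] A ⊗[k] A := Algebra.TensorProduct.includeLeft (S := k) (B := A)
  let r : A →ₐ[k] A ⊗[k] A := Algebra.TensorProduct.includeRight (A := A)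
  let d (i : MatrixPolynomial n k →ₐ[k] A) := divHom (l.comp i) (r.comp i)
  let ψ := mulHom (mulHom (d i₁) (d i₂)) (d i₃)
  have hlift (x y : A →ₐ[k] k) :
      (Algebra.TensorProduct.lift x y fun _ _ ↦ .all _ _).comp ψ = matrixEval
        (g₁ x * (g₁ y)⁻¹ * (g₂ x * (g₂ y)⁻¹) * (g₃ x * (g₃ y)⁻¹)).1 := by
    have hl : (Algebra.TensorProduct.lift x y fun _ _ ↦ .all _ _).comp l = x := by
      ext; simp [l]
    have hr : (Algebra.TensorProduct.lift x y fun _ _ ↦ .all _ _).comp r = y := by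
      ext; simp [r]
    have hd (i : MatrixPolynomial n k →ₐ[k] A) {g h : GL (Fin n) k}
        (hx : x.comp i = matrixEval g.1) (hy : y.comp i = matrixEval h.1) :
        (Algebra.TensorProduct.lift x y fun _ _ ↦ .all _ _).comp (d i) =
          matrixEval (g * h⁻¹).1 :=
      comp_divHom (by rw [← AlgHom.comp_assoc, hl, hx]) (by rw [← AlgHom.comp_assoc, hr, hy])
    exact comp_mulHom (comp_mulHom (hd _ (hx₁ x) (hx₁ y)) (hd _ (hx₂ x) (hx₂ y)))
      (hd _ (hx₃ x) (hx₃ y))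
  refine ringKrullDim_le_quotient_of_fiber_eq_diagonal ψ (matrixEval 1)
    (fun x ↦ by simp [hlift]) (fun x y hxy ↦ ?_) fun x y f hf ↦ ?_
  · rw [hlift] at hxy
    obtain ⟨h₁, h₂, h₃⟩ := htpp _ ⟨_, hg₁ x, _, hg₁ y, rfl⟩ _ ⟨_, hg₂ x, _, hg₂ y, rfl⟩ _
      ⟨_, hg₃ x, _, hg₃ y, rfl⟩ (Units.ext (matrixEval_injective hxy))
    rw [mul_inv_eq_one] at h₁ h₂ h₃
    have e₁ : x.comp j₁ = y.comp j₁ := Ideal.Quotient.algHom_ext _ (by rw [hx₁, hx₁, h₁])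
    have e₂ : x.comp j₂ = y.comp j₂ := Ideal.Quotient.algHom_ext _ (by rw [hx₂, hx₂, h₂])
    have e₃ : x.comp j₃ = y.comp j₃ := Ideal.Quotient.algHom_ext _ (by rw [hx₃, hx₃, h₃])
    exact hj x y e₁ e₂ e₃
  · rw [hlift]
    have hmem {X : Set (GL (Fin n) k)} (hX : X ⊆ G) {a b : GL (Fin n) k} (ha : a ∈ X)
        (hb : b ∈ X) : a * b⁻¹ ∈ G := G.mul_mem (hX ha) (G.inv_mem (hX hb))
    exact mem_matrixIdeal.mp hf _ ⟨_, G.mul_mem (G.mul_mem (hmem hV₁G (hg₁ x) (hg₁ y))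
      (hmem hV₂G (hg₂ x) (hg₂ y))) (hmem hV₃G (hg₃ x) (hg₃ y)), rfl⟩

end MatrixPoints

theorem stmt_18 {k : Type*} [Field k] [IsAlgClosed k] (n : ℕ)
    (G : Subgroup (GL (Fin n) k))
    -- `G` is a Zariski-closed subgroup of `GL(n, k)`
    (hG : ∃ C, IsZariskiClosed C ∧
      glImage (G : Set (GL (Fin n) k)) = {M : Matrix (Fin n) (Fin n) k | IsUnit M} ∩ C)
    (V₁ V₂ V₃ : Set (GL (Fin n) k))
    (hV₁G : V₁ ⊆ (G : Set (GL (Fin n) k)))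
    (hV₂G : V₂ ⊆ (G : Set (GL (Fin n) k)))
    (hV₃G : V₃ ⊆ (G : Set (GL (Fin n) k)))
    -- each `Vᵢ` is a Zariski-closed subvariety of `G`
    (hV₁ : ∃ C, IsZariskiClosed C ∧ glImage V₁ = glImage (G : Set (GL (Fin n) k)) ∩ C)
    (hV₂ : ∃ C, IsZariskiClosed C ∧ glImage V₂ = glImage (G : Set (GL (Fin n) k)) ∩ C)
    (hV₃ : ∃ C, IsZariskiClosed C ∧ glImage V₃ = glImage (G : Set (GL (Fin n) k)) ∩ C)
    (htpp : TripleProductProperty V₁ V₂ V₃) :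
    zariskiDim (glImage V₁) + zariskiDim (glImage V₂) + zariskiDim (glImage V₃) ≤
      zariskiDim (glImage (G : Set (GL (Fin n) k))) := by
  have hV₁ := IsZariskiClosed.glImage_of_inter hG hV₁
  have hV₂ := IsZariskiClosed.glImage_of_inter hG hV₂
  have hV₃ := IsZariskiClosed.glImage_of_inter hG hV₃
  rw [zariskiDim_glImage_eq_ringKrullDim hG, zariskiDim_glImage_eq_ringKrullDim hV₁,
    zariskiDim_glImage_eq_ringKrullDim hV₂, zariskiDim_glImage_eq_ringKrullDim hV₃]
  obtain ⟨A, _, _, j₁, j₂, j₃, _, hj, hA⟩ := exists_ringKrullDim_add_le_of_three (k := k)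
    (MatrixPolynomial n k ⧸ matrixIdeal (glImage V₁))
    (MatrixPolynomial n k ⧸ matrixIdeal (glImage V₂))
    (MatrixPolynomial n k ⧸ matrixIdeal (glImage V₃))
  exact hA.trans
    (ringKrullDim_le_of_tripleProductProperty hV₁G hV₂G hV₃G hV₁ hV₂ hV₃ htpp j₁ j₂ j₃ hj)
end
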